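/- arXiv:2507.06365 — 3 statements merged into one kernel-verified Lean document; each statement's English description precedes it below -/
import Mathlib

section
/- There exists a canonical continuous map φ : M(A,K) → Z(A,K) that is a principal bundle with structure group V*, and which moreover satisfies π∘φ = ρ. In particular, M(A,K) is weakly homotopy equivalent to Z(A,K). -/
open scoped Topology.Homotopy

/-- The map induced on path components by a continuous map. -/
def pi0Map {X Y : Type*} [TopologicalSpace X] [TopologicalSpace Y] (g : C(X, Y)) :
    ZerothHomotopy X → ZerothHomotopy Y :=
  Quotient.map g (fun _ _ h => h.elim fun p => ⟨p.map g.continuous⟩)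

/-- The map induced on homotopy groups by a continuous map. -/
def piMap {X Y : Type*} [TopologicalSpace X] [TopologicalSpace Y] (n : ℕ) (g : C(X, Y)) (x : X) :
    HomotopyGroup (Fin n) X x → HomotopyGroup (Fin n) Y (g x) :=
  Quotient.map (fun p => ⟨g.comp p.1, fun y hy => by
      simp only [ContinuousMap.comp_apply, p.2 y hy]⟩)
    (fun p q h => h.elim fun H => ⟨H.compContinuousMap g⟩)

/-- A weak homotopy equivalence: a continuous map inducing a bijection on path components
and isomorphisms on all homotopy groups at every basepoint. -/
def IsWeakHomotopyEquiv {X Y : Type*} [TopologicalSpace X] [TopologicalSpace Y]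
    (g : C(X, Y)) : Prop :=
  Function.Bijective (pi0Map g) ∧
    ∀ (n : ℕ) (x : X), Function.Bijective (piMap n g x)

/-- Composition of sign vectors: `(X ∘ Y) e = X e` if `X e ≠ 0`, and `Y e` otherwise. -/
def scomp {E : Type*} (X Y : E → SignType) : E → SignType :=
  fun e => if X e = 0 then Y e else X e

/-- The partial order on sign vectors: `X ≤ Y` iff `X ∘ Y = Y`. -/
def sle {E : Type*} (X Y : E → SignType) : Prop := scomp X Y = Y

theorem sle_refl {E : Type*} (X : E → SignType) : sle X X := by
  funext e; show (if X e = 0 then X e else X e) = X e; split <;> rfl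

theorem sle_trans {E : Type*} {X Y Z : E → SignType} (h₁ : sle X Y) (h₂ : sle Y Z) :
    sle X Z := by
  funext e
  have h1 := congrFun h₁ e
  have h2 := congrFun h₂ e
  revert h1 h2
  show (if X e = 0 then Y e else X e) = Y e → (if Y e = 0 then Z e else Y e) = Z e →
    (if X e = 0 then Z e else X e) = Z e
  generalize X e = a; generalize Y e = b; generalize Z e = c
  revert a b c; decide

theorem sle_antisymm {E : Type*} {X Y : E → SignType} (h₁ : sle X Y) (h₂ : sle Y X) :
    X = Y := by
  funext e
  have h1 := congrFun h₁ e
  have h2 := congrFun h₂ e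
  revert h1 h2
  show (if X e = 0 then Y e else X e) = Y e → (if Y e = 0 then X e else Y e) = X e → X e = Y e
  generalize X e = a; generalize Y e = b
  revert a b; decide

/-- The separating set of two sign vectors: the indices where they take opposite
nonzero signs. -/
def SepSet {E : Type*} (X Y : E → SignType) : Set E :=
  {e | (X e = 1 ∧ Y e = -1) ∨ (X e = -1 ∧ Y e = 1)}

section Geometry

variable {E : Type*} {V : Type*} [NormedAddCommGroup V] [NormedSpace ℝ V]

/-- The face of a sign vector `X`, relative to the family of cooriented affine hyperplanes
`H_e = {v | f e v = 0}`, with positive side `H_e⁺ = {v | f e v > 0}` and negative side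
`H_e⁻ = {v | f e v < 0}`. -/
def face (f : E → (V →ᵃ[ℝ] ℝ)) (X : E → SignType) : Set V :=
  {v | ∀ e, SignType.sign (f e v) = X e}

/-- The conditional oriented matroid `L(A,K)`: the set of sign vectors whose face
meets `K`. -/
def covs (f : E → (V →ᵃ[ℝ] ℝ)) (K : Set V) : Set (E → SignType) :=
  {X | (face f X ∩ K).Nonempty}

/-- A tope of `L(A,K)`: a maximal covector. -/
def IsTope (f : E → (V →ᵃ[ℝ] ℝ)) (K : Set V) (T : E → SignType) : Prop :=
  T ∈ covs f K ∧ ∀ Y ∈ covs f K, sle T Y → Y = T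

/-- The set of topes of `L(A,K)`, as a type carrying the discrete topology. -/
def Topes (f : E → (V →ᵃ[ℝ] ℝ)) (K : Set V) : Type _ := {T : E → SignType // IsTope f K T}

instance (f : E → (V →ᵃ[ℝ] ℝ)) (K : Set V) : TopologicalSpace (Topes f K) := ⊥

instance (f : E → (V →ᵃ[ℝ] ℝ)) (K : Set V) : DiscreteTopology (Topes f K) := ⟨rfl⟩

/-- Points of `K × T(A,K)`. -/
abbrev ZPre (f : E → (V →ᵃ[ℝ] ℝ)) (K : Set V) : Type _ := K × Topes f K

/-- The gluing relation defining `Z(A,K)`: `(v,T) ∼ (v',T')` iff `v = v'` and `v` lies on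
no hyperplane separating `T` from `T'`. -/
def ZRel (f : E → (V →ᵃ[ℝ] ℝ)) (K : Set V) : ZPre f K → ZPre f K → Prop :=
  fun p q => (p.1 : V) = (q.1 : V) ∧ ∀ e ∈ SepSet p.2.1 q.2.1, f e (p.1 : V) ≠ 0

/-- The space `Z(A,K)`: one copy of `K` for each tope, glued along the complement of the
separating hyperplanes, with the quotient topology. -/
def ZSpace (f : E → (V →ᵃ[ℝ] ℝ)) (K : Set V) : Type _ := Quot (ZRel f K)

instance (f : E → (V →ᵃ[ℝ] ℝ)) (K : Set V) : TopologicalSpace (ZSpace f K) :=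
  inferInstanceAs (TopologicalSpace (Quot (ZRel f K)))

/-- The projection `π : Z(A,K) → V` (with image `K`), sending `[(v,T)]` to `v`. -/
def Zproj (f : E → (V →ᵃ[ℝ] ℝ)) (K : Set V) : ZSpace f K → V :=
  Quot.lift (fun p => (p.1 : V)) (fun _ _ h => h.1)

/-- The set `K_{X,T} = K ∩ ⋂_{e : X_e = 0} H_e^{T_e}`. -/
def KXT (f : E → (V →ᵃ[ℝ] ℝ)) (K : Set V) (X T : E → SignType) : Set V :=
  K ∩ ⋂ e ∈ {e | X e = 0}, {v | SignType.sign (f e v) = T e}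

/-- The subset `U_{X,T} ⊆ Z(A,K)`: the image of `K_{X,T} × {T}` under the quotient map. -/
def UXT (f : E → (V →ᵃ[ℝ] ℝ)) (K : Set V) (X : E → SignType) (T : Topes f K) :
    Set (ZSpace f K) :=
  {z | ∃ (v : V) (hv : v ∈ K), v ∈ KXT f K X T.1 ∧ z = Quot.mk (ZRel f K) (⟨v, hv⟩, T)}

/-- The complexified complement `M(A,K)`, where `V ⊗ ℂ` is modeled as `V × V` (real and
imaginary parts): `v + iw` lies on `H_e ⊗ ℂ` iff `f e v = 0` and the linear part of `f e`
vanishes on `w`. -/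
def MSpace (f : E → (V →ᵃ[ℝ] ℝ)) (K : Set V) : Type _ :=
  {p : V × V // p.1 ∈ K ∧ ∀ e, ¬(f e p.1 = 0 ∧ (f e).linear p.2 = 0)}

instance (f : E → (V →ᵃ[ℝ] ℝ)) (K : Set V) : TopologicalSpace (MSpace f K) :=
  inferInstanceAs (TopologicalSpace {p : V × V // p.1 ∈ K ∧ _})

/-- The projection `ρ : M(A,K) → V` (with image `K`), sending `v + iw` to `v`. -/
def Mproj (f : E → (V →ᵃ[ℝ] ℝ)) (K : Set V) : MSpace f K → V := fun p => p.1.1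

end Geometry

/-- `φ : P → B` is a principal bundle for the (additive) topological group `G`, acting on
`P` via `act`: the action is continuous and fiber-preserving, and `φ` is locally trivial
with `G`-equivariant trivializations. -/
structure IsAddPrincipalBundle (G : Type*) [AddGroup G] [TopologicalSpace G]
    {P B : Type*} [TopologicalSpace P] [TopologicalSpace B]
    (act : G → P → P) (φ : P → B) : Prop where
  act_zero : ∀ p, act 0 p = p
  act_add : ∀ g g' p, act (g + g') p = act g (act g' p)
  continuous_act : Continuous fun q : G × P => act q.1 q.2
  continuous_proj : Continuous φ
  proj_act : ∀ g p, φ (act g p) = φ p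
  locTriv : ∀ b : B, ∃ U : Set B, IsOpen U ∧ b ∈ U ∧ ∃ h : (φ ⁻¹' U) ≃ₜ U × G,
    (∀ p : φ ⁻¹' U, ((h p).1 : B) = φ p.1) ∧
    ∀ (g : G) (p : φ ⁻¹' U) (hq : act g p.1 ∈ φ ⁻¹' U),
      h ⟨act g p.1, hq⟩ = ((h p).1, g + (h p).2)

open Filter Topology unitInterval

theorem isClosed_cube_boundary (N : Type*) [Finite N] : IsClosed (Cube.boundary N) := by
  have : Cube.boundary N = ⋃ i, {y : N → I | y i = 0} ∪ {y | y i = 1} := by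
    ext
    simp [Cube.boundary]
  rw [this]
  exact isClosed_iUnion_of_finite fun i =>
    (isClosed_eq (continuous_apply i) continuous_const).union
      (isClosed_eq (continuous_apply i) continuous_const)

theorem SignType.sign_eq_iff_mul_pos {s : SignType} (hs : s ≠ 0) (y : ℝ) :
    SignType.sign y = s ↔ 0 < (s : ℝ) * y := by
  cases s
  · exact absurd rfl hs
  · simp [sign_eq_neg_one_iff]
  · simp [sign_eq_one_iff]

theorem SignType.sq_coe_eq_one {s : SignType} (hs : s ≠ 0) : (s : ℝ) ^ 2 = 1 := by
  cases s
  · exact absurd rfl hs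
  · simp
  · simp

/-- For `τ = 1` this is the logarithm of `y + |x + iy|`, an increasing function of `y`; the case
`τ = -1` is its reflection through the origin. -/
noncomputable def logBarrier (τ x y : ℝ) : ℝ := τ * Real.log (τ * y + √(x ^ 2 + y ^ 2))

theorem logBarrier_arg_pos {τ x y : ℝ} (hτ : τ ^ 2 = 1) (h : x = 0 → 0 < τ * y) :
    0 < τ * y + √(x ^ 2 + y ^ 2) := by
  have hy : √((τ * y) ^ 2) ≤ √(x ^ 2 + y ^ 2) :=
    Real.sqrt_le_sqrt (by rw [mul_pow, hτ]; nlinarith [sq_nonneg x])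
  rw [Real.sqrt_sq_eq_abs] at hy
  by_cases hx : x = 0
  · nlinarith [h hx, Real.sqrt_nonneg (x ^ 2 + y ^ 2)]
  · have hlt : √((τ * y) ^ 2) < √(x ^ 2 + y ^ 2) :=
      Real.sqrt_lt_sqrt (sq_nonneg _) (by rw [mul_pow, hτ]; have := sq_pos_of_ne_zero hx; linarith)
    rw [Real.sqrt_sq_eq_abs] at hlt
    linarith [neg_abs_le (τ * y)]

theorem add_sqrt_le_add_sqrt (x : ℝ) {y z : ℝ} (h : y ≤ z) :
    y + √(x ^ 2 + y ^ 2) ≤ z + √(x ^ 2 + z ^ 2) := by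
  have hz : -z ≤ √(x ^ 2 + z ^ 2) := Real.le_sqrt_of_sq_le (by nlinarith [sq_nonneg x])
  have hs := Real.sq_sqrt (by positivity : 0 ≤ x ^ 2 + z ^ 2)
  have : √(x ^ 2 + y ^ 2) ≤ z - y + √(x ^ 2 + z ^ 2) := by
    refine Real.sqrt_le_iff.2 ⟨by have := Real.sqrt_nonneg (x ^ 2 + z ^ 2); linarith, ?_⟩
    nlinarith [mul_nonneg (sub_nonneg.2 h) (by linarith : 0 ≤ √(x ^ 2 + z ^ 2) + z)]
  linarith

theorem logBarrier_monotone {τ x y z : ℝ} (hτ : τ ^ 2 = 1) (hy : x = 0 → 0 < τ * y)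
    (hz : x = 0 → 0 < τ * z) :
    0 ≤ (logBarrier τ x y - logBarrier τ x z) * (y - z) := by
  have key : ∀ {a b : ℝ}, (x = 0 → 0 < τ * a) → τ * a ≤ τ * b →
      Real.log (τ * a + √(x ^ 2 + a ^ 2)) ≤ Real.log (τ * b + √(x ^ 2 + b ^ 2)) := by
    intro a b ha hab
    refine Real.log_le_log (logBarrier_arg_pos hτ ha) ?_
    simpa [mul_pow, hτ] using add_sqrt_le_add_sqrt x hab
  have : (logBarrier τ x y - logBarrier τ x z) * (y - z) =
      (Real.log (τ * y + √(x ^ 2 + y ^ 2)) - Real.log (τ * z + √(x ^ 2 + z ^ 2))) *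
        (τ * y - τ * z) := by
    unfold logBarrier; ring
  rw [this]
  rcases le_total (τ * y) (τ * z) with h | h
  · exact mul_nonneg_of_nonpos_of_nonpos (sub_nonpos.2 (key hy h)) (sub_nonpos.2 h)
  · exact mul_nonneg (sub_nonneg.2 (key hz h)) (sub_nonneg.2 h)

theorem logBarrier_one_sub_neg_one {x : ℝ} (hx : x ≠ 0) (y : ℝ) :
    logBarrier 1 x y - logBarrier (-1) x y = Real.log (x ^ 2) := by
  have h₁ := logBarrier_arg_pos (τ := 1) (x := x) (y := y) (by norm_num) (fun h => absurd h hx)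
  have h₂ := logBarrier_arg_pos (τ := -1) (x := x) (y := y) (by norm_num) (fun h => absurd h hx)
  have hs := Real.sq_sqrt (by positivity : 0 ≤ x ^ 2 + y ^ 2)
  unfold logBarrier
  rw [one_mul, neg_one_mul, sub_neg_eq_add, ← Real.log_mul h₁.ne' h₂.ne']
  congr 1
  linear_combination hs

theorem logBarrier_sub_logBarrier_eq {s t : SignType} (hs : s ≠ 0) (ht : t ≠ 0) {x : ℝ}
    (hst : x = 0 → s = t) (y z : ℝ) :
    logBarrier s x y - logBarrier s x z = logBarrier t x y - logBarrier t x z := by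
  by_cases hx : x = 0
  · rw [hst hx]
  · have hy := logBarrier_one_sub_neg_one hx y
    have hz := logBarrier_one_sub_neg_one hx z
    cases s <;> cases t <;> first | exact absurd rfl hs | exact absurd rfl ht | skip
    all_goals
      simp only [SignType.pos_eq_one, SignType.neg_eq_neg_one, SignType.coe_one,
        SignType.coe_neg_one]
      try linarith

theorem ContDiffAt.logBarrier {W : Type*} [NormedAddCommGroup W] [NormedSpace ℝ W] {n : ℕ∞}
    {a b : W → ℝ} {p : W} {τ : ℝ} (hτ : τ ^ 2 = 1) (ha : ContDiffAt ℝ n a p)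
    (hb : ContDiffAt ℝ n b p) (h : a p = 0 → 0 < τ * b p) :
    ContDiffAt ℝ n (fun q => logBarrier τ (a q) (b q)) p := by
  unfold _root_.logBarrier
  have hne : a p ^ 2 + b p ^ 2 ≠ 0 := by
    intro h0
    have ha0 : a p = 0 := by nlinarith [sq_nonneg (a p), sq_nonneg (b p)]
    have hb0 : b p = 0 := by nlinarith [sq_nonneg (a p), sq_nonneg (b p)]
    simpa [hb0] using h ha0
  exact contDiffAt_const.mul (((contDiffAt_const.mul hb).add
    (((ha.pow 2).add (hb.pow 2)).sqrt hne)).log (logBarrier_arg_pos hτ h).ne')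

theorem tendsto_logBarrier_zero_mul_atTop {ι : Type*} {l : Filter ι} {τ c : ℝ} (hτ : τ ^ 2 = 1)
    (hc : 0 < τ * c) {y : ι → ℝ} (hpos : ∀ i, 0 < τ * y i) (hy : Tendsto y l (𝓝 0)) :
    Tendsto (fun i => (logBarrier τ 0 (y i) - logBarrier τ 0 c) * (y i - c)) l atTop := by
  have harg : Tendsto (fun i => τ * y i + √(0 ^ 2 + y i ^ 2)) l (𝓝[>] 0) := by
    refine tendsto_nhdsWithin_iff.2 ⟨?_, .of_forall fun i =>
      logBarrier_arg_pos hτ fun _ => hpos i⟩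
    have hcont : Continuous fun t : ℝ => τ * t + √(0 ^ 2 + t ^ 2) := by fun_prop
    simpa [Function.comp_def] using (hcont.tendsto 0).comp hy
  have hlog := Real.tendsto_log_nhdsGT_zero.comp harg
  have hneg : Tendsto (fun i => τ * y i - τ * c) l (𝓝 (-(τ * c))) := by
    simpa using (hy.const_mul τ).sub_const (τ * c)
  have := (tendsto_atBot_add_const_right l (-Real.log (τ * c + √(0 ^ 2 + c ^ 2)))
    hlog).atBot_mul_neg (neg_neg_of_pos hc) hneg
  refine this.congr fun i => ?_
  simp only [logBarrier, Function.comp]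
  ring

section Adapted

variable {E : Type*} {V : Type*} [NormedAddCommGroup V] [NormedSpace ℝ V]

/-- `w` lies on the side of `H_e` prescribed by `T`, for every hyperplane `H_e` through `v`. -/
def IsAdapted (f : E → (V →ᵃ[ℝ] ℝ)) (v w : V) (T : E → SignType) : Prop :=
  ∀ e, f e v = 0 → SignType.sign ((f e).linear w) = T e

theorem AffineMap.apply_add_eq (g : V →ᵃ[ℝ] ℝ) (v w : V) : g (v + w) = g v + g.linear w := by
  have := g.map_vadd v w
  simpa [add_comm] using this

theorem IsTope.exists_isAdapted {f : E → (V →ᵃ[ℝ] ℝ)} {K : Set V} {T : E → SignType}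
    (hT : IsTope f K T) (v : V) : ∃ w, IsAdapted f v w T := by
  obtain ⟨⟨u, huT, -⟩, -⟩ := hT
  refine ⟨u - v, fun e he => ?_⟩
  have := (f e).apply_add_eq v (u - v)
  rw [add_sub_cancel, he, zero_add] at this
  rw [← this, huT e]

theorem isAdapted_iff {f : E → (V →ᵃ[ℝ] ℝ)} {T : E → SignType} (hT : ∀ e, T e ≠ 0)
    {v w : V} :
    IsAdapted f v w T ↔ ∀ e, f e v = 0 → 0 < (T e : ℝ) * (f e).linear w :=
  forall_congr' fun e => imp_congr_right fun _ => SignType.sign_eq_iff_mul_pos (hT e) _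

theorem convex_isAdapted {f : E → (V →ᵃ[ℝ] ℝ)} {T : E → SignType} (hT : ∀ e, T e ≠ 0)
    (v : V) : Convex ℝ {w : V | IsAdapted f v w T} := by
  simp only [isAdapted_iff hT]
  intro w hw u hu a b ha hb hab e he
  have h₁ := hw e he
  have h₂ := hu e he
  simp only [map_add, map_smul, smul_eq_mul]
  have : 0 < a * ((T e : ℝ) * (f e).linear w) + b * ((T e : ℝ) * (f e).linear u) := by
    rcases ha.eq_or_lt with rfl | ha
    · rw [zero_add] at hab
      simpa [hab] using h₂
    · exact add_pos_of_pos_of_nonneg (mul_pos ha h₁) (mul_nonneg hb h₂.le)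
  linarith

theorem logBarrier_sub_mul_sub_nonneg {f : E → (V →ᵃ[ℝ] ℝ)} {T : E → SignType}
    (hT : ∀ e, T e ≠ 0) {v w u : V} (hw : IsAdapted f v w T)
    (hu : IsAdapted f v u T) (e : E) :
    0 ≤ (logBarrier (T e) (f e v) ((f e).linear w) -
      logBarrier (T e) (f e v) ((f e).linear u)) * ((f e).linear w - (f e).linear u) :=
  logBarrier_monotone (SignType.sq_coe_eq_one (hT e)) ((isAdapted_iff hT).1 hw e)
    ((isAdapted_iff hT).1 hu e)

theorem continuous_zProj {f : E → (V →ᵃ[ℝ] ℝ)} {K : Set V} : Continuous (Zproj f K) :=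
  continuous_quot_lift _ (continuous_subtype_val.comp continuous_fst)

variable [FiniteDimensional ℝ V]

theorem AffineMap.contDiff_of_finiteDimensional (g : V →ᵃ[ℝ] ℝ) {n : WithTop ℕ∞} :
    ContDiff ℝ n g := by
  rw [show (g : V → ℝ) = fun v => LinearMap.toContinuousLinearMap g.linear v + g 0 from
    g.decomp]
  fun_prop

theorem eventually_sign_add_smul (g : V →ᵃ[ℝ] ℝ) (v w : V) :
    ∀ᶠ ε : ℝ in 𝓝[>] 0, SignType.sign (g (v + ε • w)) =
      if g v = 0 then SignType.sign (g.linear w) else SignType.sign (g v) := by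
  split_ifs with h
  · filter_upwards [self_mem_nhdsWithin] with ε hε
    rw [g.apply_add_eq, h, zero_add, map_smul, smul_eq_mul, sign_mul, sign_pos hε, one_mul]
  · have hc : ContinuousAt (fun ε : ℝ => SignType.sign (g (v + ε • w))) 0 := by
      refine ContinuousAt.comp (f := fun ε : ℝ => g (v + ε • w)) ?_ ?_
      · simpa using continuousAt_sign_of_ne_zero h
      · have := (g.contDiff_of_finiteDimensional (n := 0)).continuous
        fun_prop
    have := hc.tendsto
    rw [nhds_discrete SignType, tendsto_pure] at this
    simpa using this.filter_mono nhdsWithin_le_nhds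

variable [Fintype E]

theorem exists_mem_sign_eq {f : E → (V →ᵃ[ℝ] ℝ)} {K : Set V} (hK : IsOpen K) {v : V} (hv : v ∈ K)
    (w : V) : ∃ u ∈ K, ∀ e, SignType.sign (f e u) =
      if f e v = 0 then SignType.sign ((f e).linear w) else SignType.sign (f e v) := by
  have hmem : ∀ᶠ ε : ℝ in 𝓝[>] 0, v + ε • w ∈ K := by
    have hc : Continuous fun ε : ℝ => v + ε • w := by fun_prop
    exact (hc.tendsto 0 |>.eventually (hK.mem_nhds (by simpa))).filter_mono nhdsWithin_le_nhds
  obtain ⟨ε, hε, hs⟩ :=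
    (hmem.and (eventually_all.2 fun e => eventually_sign_add_smul (f e) v w)).exists
  exact ⟨_, hε, hs⟩

theorem IsTope.ne_zero {f : E → (V →ᵃ[ℝ] ℝ)} (hf : ∀ e, (f e).linear ≠ 0) {K : Set V}
    (hK : IsOpen K) {T : E → SignType} (hT : IsTope f K T) (e : E) : T e ≠ 0 := by
  intro he
  obtain ⟨⟨v, hvT, hvK⟩, hmax⟩ := hT
  obtain ⟨w, hw⟩ : ∃ w, (f e).linear w ≠ 0 := by
    by_contra! h
    exact hf e (LinearMap.ext h)
  obtain ⟨u, huK, hu⟩ := exists_mem_sign_eq (f := f) hK hvK w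
  have hY := hmax (fun e => SignType.sign (f e u)) ⟨u, fun _ => rfl, huK⟩ (by
    funext i
    by_cases hi : T i = 0
    · simp [scomp, hi]
    · have : f i v ≠ 0 := fun h0 => hi (by rw [← hvT i, h0, sign_zero])
      simp [scomp, hu i, this, ← hvT i])
  have h1 := congrFun hY e
  have hev : f e v = 0 := sign_eq_zero_iff.1 ((hvT e).trans he)
  simp only [hu e, hev, if_true, he] at h1
  exact hw (sign_eq_zero_iff.1 h1)

theorem exists_tope_isAdapted {f : E → (V →ᵃ[ℝ] ℝ)} {K : Set V} (hK : IsOpen K) {v w : V}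
    (hv : v ∈ K) (hw : ∀ e, ¬(f e v = 0 ∧ (f e).linear w = 0)) :
    ∃ T : Topes f K, IsAdapted f v w T.1 := by
  obtain ⟨u, huK, hu⟩ := exists_mem_sign_eq (f := f) hK hv w
  have hne : ∀ e, SignType.sign (f e u) ≠ 0 := by
    intro e
    rw [hu e]
    split_ifs with h
    · exact fun h0 => hw e ⟨h, sign_eq_zero_iff.1 h0⟩
    · exact fun h0 => h (sign_eq_zero_iff.1 h0)
  refine ⟨⟨fun e => SignType.sign (f e u), ⟨u, fun _ => rfl, huK⟩, fun Y _ hY => ?_⟩, ?_⟩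
  · rw [← hY]
    funext e
    simp only [scomp, if_neg (hne e)]
  · intro e he
    simp [hu e, he]

theorem isOpen_isAdapted {f : E → (V →ᵃ[ℝ] ℝ)} {T : E → SignType} (hT : ∀ e, T e ≠ 0) :
    IsOpen {p : V × V | IsAdapted f p.1 p.2 T} := by
  simp only [isAdapted_iff hT, Set.ofPred_forall]
  refine isOpen_iInter_of_finite fun e => ?_
  simp only [imp_iff_not_or]
  have h₁ := ((f e).contDiff_of_finiteDimensional (n := 0)).continuous
  have h₂ := (f e).linear.continuous_of_finiteDimensional
  exact (isOpen_ne_fun (h₁.comp continuous_fst) continuous_const).union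
    (isOpen_lt continuous_const (continuous_const.mul (h₂.comp continuous_snd)))

open scoped RealInnerProductSpace

/-- The differential, in the imaginary direction, of a strictly convex potential on the adapted
cone of `T` over `v`. -/
noncomputable def momentum (f : E → (V →ᵃ[ℝ] ℝ)) (T : E → SignType) (p : V × V) : V →L[ℝ] ℝ :=
  (innerSL ℝ (toEuclidean p.2)).comp (toEuclidean : V ≃L[ℝ] _).toContinuousLinearMap +
    ∑ e, logBarrier (T e) (f e p.1) ((f e).linear p.2) •
      LinearMap.toContinuousLinearMap (f e).linear

theorem momentum_apply (f : E → (V →ᵃ[ℝ] ℝ)) (T : E → SignType) (p : V × V) (u : V) :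
    momentum f T p u = ⟪toEuclidean p.2, toEuclidean u⟫ +
      ∑ e, logBarrier (T e) (f e p.1) ((f e).linear p.2) * (f e).linear u := by
  simp [momentum]

theorem momentum_sub_apply_sub (f : E → (V →ᵃ[ℝ] ℝ)) (T : E → SignType) (v w u : V) :
    (momentum f T (v, w) - momentum f T (v, u)) (w - u) = ‖toEuclidean (w - u)‖ ^ 2 +
      ∑ e, (logBarrier (T e) (f e v) ((f e).linear w) -
        logBarrier (T e) (f e v) ((f e).linear u)) * ((f e).linear w - (f e).linear u) := by
  rw [← real_inner_self_eq_norm_sq]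
  simp only [sub_apply, momentum_apply, map_sub, inner_sub_left,
    inner_sub_right, sub_mul, mul_sub, Finset.sum_sub_distrib]
  ring

/-- The value of the momentum changes between two topes by a covector depending only on `v`. -/
theorem momentum_sub_momentum_eq {f : E → (V →ᵃ[ℝ] ℝ)} {S T : E → SignType} (hS : ∀ e, S e ≠ 0)
    (hT : ∀ e, T e ≠ 0) {v : V} (hST : ∀ e, f e v = 0 → S e = T e) (w u : V) :
    momentum f S (v, w) - momentum f S (v, u) = momentum f T (v, w) - momentum f T (v, u) := by
  ext x
  simp only [sub_apply, momentum_apply, add_sub_add_comm,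
    ← Finset.sum_sub_distrib, ← sub_mul]
  congr 1
  exact Finset.sum_congr rfl fun e _ => by
    rw [logBarrier_sub_logBarrier_eq (hS e) (hT e) (hST e)]

section Adapted

variable {f : E → (V →ᵃ[ℝ] ℝ)} {T : E → SignType} (hT : ∀ e, T e ≠ 0)

include hT

theorem norm_sq_le_momentum_sub {v w u : V} (hw : IsAdapted f v w T) (hu : IsAdapted f v u T) :
    ‖toEuclidean (w - u)‖ ^ 2 ≤ (momentum f T (v, w) - momentum f T (v, u)) (w - u) := by
  rw [momentum_sub_apply_sub]
  exact le_add_of_nonneg_right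
    (Finset.sum_nonneg fun e _ => logBarrier_sub_mul_sub_nonneg hT hw hu e)

theorem logBarrier_sub_mul_sub_le {v w u : V} (hw : IsAdapted f v w T)
    (hu : IsAdapted f v u T) (e : E) :
    (logBarrier (T e) (f e v) ((f e).linear w) -
      logBarrier (T e) (f e v) ((f e).linear u)) * ((f e).linear w - (f e).linear u) ≤
      (momentum f T (v, w) - momentum f T (v, u)) (w - u) := by
  rw [momentum_sub_apply_sub]
  exact le_add_of_nonneg_of_le (sq_nonneg _)
    (Finset.single_le_sum (fun e _ => logBarrier_sub_mul_sub_nonneg hT hw hu e)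
      (Finset.mem_univ e))

theorem momentum_injective {v w u : V} (hw : IsAdapted f v w T) (hu : IsAdapted f v u T)
    (h : momentum f T (v, w) = momentum f T (v, u)) : w = u := by
  have := norm_sq_le_momentum_sub hT hw hu
  rw [h, sub_self, zero_apply] at this
  have h0 : ‖toEuclidean (w - u)‖ = 0 := by
    nlinarith [norm_nonneg (toEuclidean (w - u))]
  simpa [sub_eq_zero] using h0

theorem contDiffAt_momentum {p : V × V} (hp : IsAdapted f p.1 p.2 T) :
    ContDiffAt ℝ 1 (momentum f T) p := by
  unfold momentum
  refine ContDiffAt.add (ContDiff.contDiffAt ?_) (ContDiffAt.sum fun e _ => ?_)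
  · refine contDiff_clm_apply_iff.2 fun u => ?_
    have : ContDiff ℝ 1 fun p : V × V => toEuclidean p.2 :=
      (toEuclidean (E := V)).contDiff.comp contDiff_snd
    simpa using this.inner ℝ contDiff_const
  · have h : ContDiffAt ℝ 1
        (fun p : V × V => logBarrier (T e) (f e p.1) ((f e).linear p.2)) p := by
      refine ContDiffAt.logBarrier (n := 1) (SignType.sq_coe_eq_one (hT e)) ?_ ?_
        ((isAdapted_iff hT).1 hp e)
      · exact ((f e).contDiff_of_finiteDimensional.comp contDiff_fst).contDiffAt
      · exact ((LinearMap.toContinuousLinearMap (f e).linear : V →L[ℝ] ℝ).contDiff.comp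
          (contDiff_snd (E := V) (F := V))).contDiffAt
    exact h.smul contDiffAt_const

theorem map_nhds_prodMk_momentum {p : V × V} (hp : IsAdapted f p.1 p.2 T) :
    map (fun q : V × V => (q.1, momentum f T q)) (𝓝 p) = 𝓝 (p.1, momentum f T p) := by
  have hd : HasStrictFDerivAt (momentum f T) (fderiv ℝ (momentum f T) p) p :=
    (contDiffAt_momentum hT hp).hasStrictFDerivAt one_ne_zero
  refine (hasStrictFDerivAt_fst.prodMk hd).map_nhds_eq_of_surj ?_
  rw [← LinearMap.ker_eq_bot_iff_range_eq_top_of_finrank_eq_finrank (by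
    rw [Module.finrank_prod, Module.finrank_prod,
      ← (LinearMap.toContinuousLinearMap (𝕜 := ℝ) (E := V) (F' := ℝ)).finrank_eq,
      Subspace.dual_finrank_eq])]
  refine (Submodule.eq_bot_iff _).2 fun x hx => ?_
  obtain ⟨a, b⟩ := x
  obtain ⟨ha, hb⟩ := Prod.mk.inj hx
  obtain rfl : a = 0 := ha
  replace hb : fderiv ℝ (momentum f T) p (0, b) = 0 := hb
  have hline : HasDerivAt (fun t : ℝ => momentum f T (p + t • (0, b))) 0 0 := by
    have hl : HasDerivAt (fun t : ℝ => p + t • ((0 : V), b)) ((0 : V), b) 0 := by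
      simpa using ((hasDerivAt_id (0 : ℝ)).smul_const ((0 : V), b)).const_add p
    have := (show HasFDerivAt (momentum f T) (fderiv ℝ (momentum f T) p)
      (p + (0 : ℝ) • ((0 : V), b)) by simpa using hd.hasFDerivAt).comp_hasDerivAt 0 hl
    rwa [hb] at this
  have hlim : Tendsto (fun t : ℝ => (t⁻¹ • (momentum f T (p + t • (0, b)) - momentum f T p)) b)
      (𝓝[>] 0) (𝓝 0) := by
    have := hline.tendsto_slope_zero_right
    simp only [zero_add, zero_smul, add_zero] at this
    exact ((ContinuousLinearMap.apply ℝ ℝ b).continuous.tendsto' 0 0 (by simp)).comp this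
  have hev : ∀ᶠ t : ℝ in 𝓝[>] 0, IsAdapted f p.1 (p.2 + t • b) T := by
    have hc : Continuous fun t : ℝ => ((p.1, p.2 + t • b) : V × V) := by fun_prop
    exact (hc.tendsto 0 |>.eventually ((isOpen_isAdapted hT).mem_nhds
      (by simpa using hp))).filter_mono nhdsWithin_le_nhds
  have hle : ‖toEuclidean b‖ ^ 2 ≤ 0 := by
    refine ge_of_tendsto hlim ?_
    filter_upwards [hev, self_mem_nhdsWithin] with t ht htpos
    have htpos : 0 < t := htpos
    have := norm_sq_le_momentum_sub hT ht hp
    simp only [add_sub_cancel_left, map_smul, norm_smul, mul_pow, Real.norm_eq_abs, sq_abs,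
      smul_eq_mul] at this
    have hpt : p + t • ((0 : V), b) = (p.1, p.2 + t • b) := by ext <;> simp
    rw [hpt, smul_apply, smul_eq_mul, inv_mul_eq_div, le_div_iff₀ htpos]
    nlinarith
  have hb0 : ‖toEuclidean b‖ = 0 := by nlinarith [norm_nonneg (toEuclidean b)]
  have : b = 0 := by simpa using hb0
  rw [this]; rfl

theorem exists_norm_sub_le_norm_momentum_sub : ∃ C : ℝ, ∀ v w u : V, IsAdapted f v w T →
    IsAdapted f v u T → ‖w - u‖ ≤ C * ‖momentum f T (v, w) - momentum f T (v, u)‖ := by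
  set c := ‖((toEuclidean : V ≃L[ℝ] _).symm.toContinuousLinearMap)‖ with hc
  refine ⟨c ^ 2, fun v w u hw hu => ?_⟩
  have h₁ : ‖w - u‖ ≤ c * ‖toEuclidean (w - u)‖ := by
    simpa using ((toEuclidean : V ≃L[ℝ] _).symm.toContinuousLinearMap).le_opNorm
      (toEuclidean (w - u))
  have h₂ := norm_sq_le_momentum_sub hT hw hu
  have h₃ := (le_abs_self _).trans
    ((momentum f T (v, w) - momentum f T (v, u)).le_opNorm (w - u))
  set m := ‖momentum f T (v, w) - momentum f T (v, u)‖
  rcases (norm_nonneg (w - u)).eq_or_lt with h0 | hpos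
  · rw [← h0]; positivity
  · refine le_of_mul_le_mul_right ?_ hpos
    calc ‖w - u‖ * ‖w - u‖ ≤ (c * ‖toEuclidean (w - u)‖) * (c * ‖toEuclidean (w - u)‖) := by
          gcongr
      _ = c ^ 2 * ‖toEuclidean (w - u)‖ ^ 2 := by ring
      _ ≤ c ^ 2 * (m * ‖w - u‖) := by gcongr; exact h₂.trans h₃
      _ = c ^ 2 * m * ‖w - u‖ := by ring

theorem isClosed_image_momentum (v : V) :
    IsClosed ((fun w => momentum f T (v, w)) '' {w | IsAdapted f v w T}) := by
  refine isClosed_of_closure_subset fun μ hμ => ?_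
  obtain ⟨μs, hμs, hlim⟩ := mem_closure_iff_seq_limit.1 hμ
  choose w hw hwμ using hμs
  obtain ⟨C, hC⟩ := exists_norm_sub_le_norm_momentum_sub (f := f) hT
  obtain ⟨R, hR⟩ : ∃ R, ∀ n, ‖μs n - μs 0‖ ≤ R := by
    obtain ⟨R, hR⟩ := (hlim.sub_const (μs 0)).norm.bddAbove_range
    exact ⟨R, fun n => hR ⟨n, rfl⟩⟩
  have hR0 : 0 ≤ R := (norm_nonneg _).trans (hR 0)
  have hbound : ∀ n, ‖w n - w 0‖ ≤ |C| * R := fun n => by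
    refine (hC v _ _ (hw n) (hw 0)).trans ?_
    simp only [hwμ]
    exact mul_le_mul (le_abs_self C) (hR n) (norm_nonneg _) (abs_nonneg _)
  obtain ⟨u, -, k, hk, hku⟩ := tendsto_subseq_of_bounded
    (Metric.isBounded_closedBall (x := w 0) (r := |C| * R))
    (fun n => by simpa [dist_eq_norm] using hbound n)
  have hlin : ∀ e, Tendsto (fun n => (f e).linear (w (k n))) atTop (𝓝 ((f e).linear u)) :=
    fun e => ((f e).linear.continuous_of_finiteDimensional.tendsto u).comp hku
  have hu : IsAdapted f v u T := by
    refine (isAdapted_iff hT).2 fun e he => ?_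
    have hpos : ∀ n, 0 < (T e : ℝ) * (f e).linear (w n) :=
      fun n => (isAdapted_iff hT).1 (hw n) e he
    refine (ge_of_tendsto' ((hlin e).const_mul (T e : ℝ)) fun n => (hpos (k n)).le).lt_of_ne ?_
    intro h0
    have hu0 : (f e).linear u = 0 := by
      have : (T e : ℝ) ≠ 0 := fun h => by simpa [h] using SignType.sq_coe_eq_one (hT e)
      simpa [this] using h0.symm
    have htop := tendsto_logBarrier_zero_mul_atTop (SignType.sq_coe_eq_one (hT e)) (hpos 0)
      (fun n => hpos (k n)) (hu0 ▸ hlin e)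
    obtain ⟨n, hn⟩ := (htop.eventually_gt_atTop (R * (|C| * R))).exists
    have h₁ := logBarrier_sub_mul_sub_le hT (hw (k n)) (hw 0) e
    have h₂ := (le_abs_self _).trans
      ((momentum f T (v, w (k n)) - momentum f T (v, w 0)).le_opNorm (w (k n) - w 0))
    simp only [hwμ] at h₂
    rw [he] at h₁
    have h₃ := mul_le_mul (hR (k n)) (hbound (k n)) (norm_nonneg _) hR0
    simp only [hwμ] at h₁
    linarith
  refine ⟨u, hu, ?_⟩
  have hcont := (contDiffAt_momentum hT (p := (v, u)) hu).continuousAt.tendsto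
  refine tendsto_nhds_unique (hcont.comp (tendsto_const_nhds.prodMk_nhds hku)) ?_
  exact (hlim.comp hk.tendsto_atTop).congr fun n => (hwμ (k n)).symm

theorem exists_momentum_eq {v : V} (hne : ∃ w, IsAdapted f v w T) (μ : V →L[ℝ] ℝ) :
    ∃ w, IsAdapted f v w T ∧ momentum f T (v, w) = μ := by
  have hopen : IsOpen ((fun w => momentum f T (v, w)) '' {w | IsAdapted f v w T}) := by
    refine isOpen_iff_mem_nhds.2 ?_
    rintro _ ⟨w, hw, rfl⟩
    have hmem : {q : V × V | IsAdapted f q.1 q.2 T} ∈ 𝓝 (v, w) :=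
      (isOpen_isAdapted hT).mem_nhds hw
    have himg := image_mem_map (m := fun q : V × V => (q.1, momentum f T q)) hmem
    rw [map_nhds_prodMk_momentum hT (p := (v, w)) hw] at himg
    have hc : Continuous fun μ : V →L[ℝ] ℝ => (v, μ) := by fun_prop
    filter_upwards [hc.continuousAt.preimage_mem_nhds himg]
    rintro μ' ⟨q, hq, hqμ⟩
    obtain ⟨rfl, rfl⟩ := Prod.mk.inj hqμ
    exact ⟨q.2, hq, rfl⟩
  obtain ⟨w₀, hw₀⟩ := hne
  have huniv := IsClopen.eq_univ ⟨isClosed_image_momentum hT v, hopen⟩ ⟨_, w₀, hw₀, rfl⟩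
  exact Set.eq_univ_iff_forall.1 huniv μ

end Adapted

section Bundle

variable {f : E → (V →ᵃ[ℝ] ℝ)} {K : Set V} (hf : ∀ e, (f e).linear ≠ 0) (hK : IsOpen K)

include hf hK

theorem isOpenEmbedding_val_mSpace :
    IsOpenEmbedding (fun m : MSpace f K => (m.1 : V × V)) := by
  refine IsOpen.isOpenEmbedding_subtypeVal (isOpen_iff_mem_nhds.2 fun p hp => ?_)
  obtain ⟨T, hT⟩ := exists_tope_isAdapted hK hp.1 hp.2
  have hT0 := T.2.ne_zero hf hK
  filter_upwards [(isOpen_isAdapted hT0).mem_nhds hT,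
    (hK.preimage continuous_fst).mem_nhds hp.1] with q hq hqK
  exact ⟨hqK, fun e h => hT0 e (by rw [← hq e h.1, h.2, sign_zero])⟩

theorem map_nhds_mSpace {T : Topes f K} {m : MSpace f K} (hm : IsAdapted f m.1.1 m.1.2 T.1) :
    map (fun m : MSpace f K => (m.1.1, momentum f T.1 m.1)) (𝓝 m) =
      𝓝 (m.1.1, momentum f T.1 m.1) := by
  rw [← map_nhds_prodMk_momentum (T.2.ne_zero hf hK) hm,
    ← (isOpenEmbedding_val_mSpace hf hK).map_nhds_eq m, map_map]
  rfl

theorem mSpace_ext_of_momentum {T : Topes f K} {m m' : MSpace f K}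
    (hm : IsAdapted f m.1.1 m.1.2 T.1) (hm' : IsAdapted f m'.1.1 m'.1.2 T.1)
    (h : (m.1.1, momentum f T.1 m.1) = (m'.1.1, momentum f T.1 m'.1)) : m = m' := by
  obtain ⟨⟨v, w⟩, h₁⟩ := m
  obtain ⟨⟨v', w'⟩, h₂⟩ := m'
  obtain ⟨h₃, h₄⟩ := Prod.mk.inj h
  obtain rfl : v = v' := h₃
  obtain rfl := momentum_injective (T.2.ne_zero hf hK) hm hm' h₄
  rfl

theorem isOpen_adapted_mSpace (T : Topes f K) :
    IsOpen {m : MSpace f K | IsAdapted f m.1.1 m.1.2 T.1} :=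
  (isOpen_isAdapted (T.2.ne_zero hf hK)).preimage (isOpenEmbedding_val_mSpace hf hK).continuous

theorem exists_mSpace_eq {T : Topes f K} {v w : V} (hv : v ∈ K) (h : IsAdapted f v w T.1) :
    ∃ m : MSpace f K, m.1 = (v, w) :=
  ⟨⟨(v, w), hv, fun e he => T.2.ne_zero hf hK e (by rw [← h e he.1, he.2, sign_zero])⟩, rfl⟩

theorem zMk_eq_zMk_iff {p q : ZPre f K} : Quot.mk (ZRel f K) p = Quot.mk (ZRel f K) q ↔
    (p.1 : V) = q.1 ∧ ∀ e, f e p.1 = 0 → p.2.1 e = q.2.1 e := by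
  have key : ∀ a b : ZPre f K, ZRel f K a b ↔
      (a.1 : V) = b.1 ∧ ∀ e, f e a.1 = 0 → a.2.1 e = b.2.1 e := by
    refine fun a b => and_congr_right fun _ => forall_congr' fun e => ?_
    have ha := a.2.2.ne_zero hf hK e
    have hb := b.2.2.ne_zero hf hK e
    rw [show e ∈ SepSet a.2.1 b.2.1 ↔ a.2.1 e ≠ b.2.1 e from ?_]
    · tauto
    · simp only [SepSet, Set.mem_ofPred_eq]
      revert ha hb
      generalize a.2.1 e = s
      generalize b.2.1 e = t
      revert s t
      decide
  refine ⟨fun h => ?_, fun h => Quot.sound ((key p q).2 h)⟩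
  have hlift := congrArg (Quot.lift
    (fun a : ZPre f K => ((a.1 : V), fun e => if f e a.1 = 0 then a.2.1 e else 0))
    (fun a b hab => by
      obtain ⟨h₁, h₂⟩ := (key a b).1 hab
      refine Prod.ext h₁ (funext fun e => ?_)
      simp only [← h₁]
      split_ifs with h0
      · exact h₂ e h0
      · rfl)) h
  obtain ⟨h₁, h₂⟩ := Prod.mk.inj hlift
  refine ⟨h₁, fun e he => ?_⟩
  simpa [← h₁, he] using congrFun h₂ e

theorem isOpen_range_zMk (T : Topes f K) :
    IsOpen (Set.range fun v : K => (Quot.mk (ZRel f K) (v, T) : ZSpace f K)) := by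
  refine isOpen_coinduced.2 ?_
  have : (Quot.mk (ZRel f K)) ⁻¹' (Set.range fun v : K => Quot.mk (ZRel f K) (v, T)) =
      ⋂ e, {p : ZPre f K | f e p.1 ≠ 0} ∪ {p | T.1 e = p.2.1 e} := by
    ext p
    simp only [Set.mem_preimage, Set.mem_range, zMk_eq_zMk_iff hf hK, Set.mem_iInter,
      Set.mem_union, Set.mem_ofPred_eq]
    constructor
    · rintro ⟨v, hv, h⟩ e
      rw [← hv]
      exact or_iff_not_imp_left.2 fun h0 => h e (not_not.1 h0)
    · exact fun h => ⟨p.1, rfl, fun e he => (h e).resolve_left (not_not.2 he)⟩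
  rw [this]
  refine isOpen_iInter_of_finite fun e => IsOpen.union ?_ ?_
  · have h₁ := ((f e).contDiff_of_finiteDimensional (n := 0)).continuous
    exact isOpen_ne_fun (h₁.comp (continuous_subtype_val.comp continuous_fst)) continuous_const
  · exact (isOpen_discrete {S : Topes f K | T.1 e = S.1 e}).preimage continuous_snd

theorem exists_continuousMap_zSpace : ∃ φ : C(MSpace f K, ZSpace f K), ∀ m T,
    IsAdapted f m.1.1 m.1.2 T.1 → φ m = Quot.mk (ZRel f K) (⟨m.1.1, m.2.1⟩, T) := by
  choose T hT using fun m : MSpace f K => exists_tope_isAdapted hK m.2.1 m.2.2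
  have heq : ∀ m S, IsAdapted f m.1.1 m.1.2 S.1 →
      (Quot.mk (ZRel f K) (⟨m.1.1, m.2.1⟩, T m)) = Quot.mk (ZRel f K) (⟨m.1.1, m.2.1⟩, S) :=
    fun m S hS => (zMk_eq_zMk_iff hf hK).2 ⟨rfl, fun e he => (hT m e he).symm.trans (hS e he)⟩
  refine ⟨⟨fun m => Quot.mk (ZRel f K) (⟨m.1.1, m.2.1⟩, T m), ?_⟩, heq⟩
  refine continuous_iff_continuousAt.2 fun m => ?_
  have hc : Continuous fun m' : MSpace f K =>
      (Quot.mk (ZRel f K) (⟨m'.1.1, m'.2.1⟩, T m) : ZSpace f K) :=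
    continuous_quot_mk.comp (((continuous_fst.comp
      (isOpenEmbedding_val_mSpace hf hK).continuous).subtype_mk _).prodMk continuous_const)
  refine hc.continuousAt.congr ?_
  filter_upwards [(isOpen_adapted_mSpace hf hK (T m)).mem_nhds (hT m)] with m' hm'
  exact (heq m' _ hm').symm

theorem exists_translation (g : V →L[ℝ] ℝ) (m : MSpace f K) : ∃ m' : MSpace f K,
    m'.1.1 = m.1.1 ∧ ∀ T : Topes f K, IsAdapted f m.1.1 m.1.2 T.1 →
      IsAdapted f m'.1.1 m'.1.2 T.1 ∧ momentum f T.1 m'.1 = g + momentum f T.1 m.1 := by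
  obtain ⟨S, hS⟩ := exists_tope_isAdapted hK m.2.1 m.2.2
  obtain ⟨w, hw, hwS⟩ := exists_momentum_eq (S.2.ne_zero hf hK) ⟨_, hS⟩ (g + momentum f S.1 m.1)
  obtain ⟨m', hm'⟩ := exists_mSpace_eq hf hK m.2.1 hw
  refine ⟨m', by rw [hm'], fun T hT => ?_⟩
  have hST : ∀ e, f e m.1.1 = 0 → S.1 e = T.1 e := fun e he => (hS e he).symm.trans (hT e he)
  have hdiff := momentum_sub_momentum_eq (S.2.ne_zero hf hK) (T.2.ne_zero hf hK) hST w m.1.2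
  rw [hm']
  refine ⟨fun e he => (hw e he).trans (hST e he), ?_⟩
  rw [hwS, Prod.mk.eta, add_sub_cancel_right] at hdiff
  exact (sub_eq_iff_eq_add.1 hdiff.symm)

variable {φ : C(MSpace f K, ZSpace f K)} (hφ : ∀ m T, IsAdapted f m.1.1 m.1.2 T.1 →
  φ m = Quot.mk (ZRel f K) (⟨m.1.1, m.2.1⟩, T))

include hφ

theorem proj_eq_zMk_iff {m : MSpace f K} {v : K} {T : Topes f K} :
    φ m = Quot.mk (ZRel f K) (v, T) ↔ m.1.1 = v ∧ IsAdapted f m.1.1 m.1.2 T.1 := by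
  obtain ⟨S, hS⟩ := exists_tope_isAdapted hK m.2.1 m.2.2
  rw [hφ m S hS]
  refine (zMk_eq_zMk_iff hf hK).trans ?_
  refine and_congr_right fun _ => forall_congr' fun e => ?_
  exact forall_congr' fun he => by rw [hS e he]

omit hf in
theorem zProj_proj (m : MSpace f K) : Zproj f K (φ m) = m.1.1 := by
  obtain ⟨S, hS⟩ := exists_tope_isAdapted hK m.2.1 m.2.2
  rw [hφ m S hS]
  rfl

theorem isAddPrincipalBundle_of_translation {act : (V →L[ℝ] ℝ) → MSpace f K → MSpace f K}
    (hact₁ : ∀ g m, (act g m).1.1 = m.1.1)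
    (hact₂ : ∀ g m (T : Topes f K), IsAdapted f m.1.1 m.1.2 T.1 →
      IsAdapted f (act g m).1.1 (act g m).1.2 T.1 ∧
        momentum f T.1 (act g m).1 = g + momentum f T.1 m.1) :
    IsAddPrincipalBundle (V →L[ℝ] ℝ) act φ where
  act_zero m := by
    obtain ⟨T, hT⟩ := exists_tope_isAdapted hK m.2.1 m.2.2
    obtain ⟨h₁, h₂⟩ := hact₂ 0 m T hT
    exact mSpace_ext_of_momentum hf hK h₁ hT (by rw [hact₁, h₂, zero_add])
  act_add g g' m := by
    obtain ⟨T, hT⟩ := exists_tope_isAdapted hK m.2.1 m.2.2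
    obtain ⟨h₁, h₂⟩ := hact₂ (g + g') m T hT
    obtain ⟨h₃, h₄⟩ := hact₂ g' m T hT
    obtain ⟨h₅, h₆⟩ := hact₂ g (act g' m) T h₃
    exact mSpace_ext_of_momentum hf hK h₁ h₅ (by
      rw [hact₁, hact₁, hact₁, h₂, h₆, h₄, add_assoc])
  continuous_act := by
    refine continuous_iff_continuousAt.2 fun ⟨g, m⟩ => ?_
    obtain ⟨T, hT⟩ := exists_tope_isAdapted hK m.2.1 m.2.2
    obtain ⟨h₁, h₂⟩ := hact₂ g m T hT
    have hdom : ∀ᶠ q : (V →L[ℝ] ℝ) × MSpace f K in 𝓝 (g, m),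
        IsAdapted f q.2.1.1 q.2.1.2 T.1 :=
      continuousAt_snd.eventually (p := fun m : MSpace f K => IsAdapted f m.1.1 m.1.2 T.1)
        ((isOpen_adapted_mSpace hf hK T).mem_nhds hT)
    have hval := (isOpenEmbedding_val_mSpace hf hK).continuous
    have hlim : Tendsto (fun q : (V →L[ℝ] ℝ) × MSpace f K =>
        ((act q.1 q.2).1.1, momentum f T.1 (act q.1 q.2).1)) (𝓝 (g, m))
        (𝓝 ((act g m).1.1, momentum f T.1 (act g m).1)) := by
      have hmom : ContinuousAt (fun m : MSpace f K => momentum f T.1 m.1) m :=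
        ContinuousAt.comp (f := fun m : MSpace f K => (m.1 : V × V))
          (contDiffAt_momentum (T.2.ne_zero hf hK) hT).continuousAt hval.continuousAt
      have hc : ContinuousAt (fun q : (V →L[ℝ] ℝ) × MSpace f K =>
          ((q.2.1.1, q.1 + momentum f T.1 q.2.1) : V × (V →L[ℝ] ℝ))) (g, m) :=
        ((continuous_fst.comp hval).comp continuous_snd).continuousAt.prodMk
          (continuousAt_fst.add (ContinuousAt.comp (f := Prod.snd) (x := (g, m))
            hmom continuousAt_snd))
      rw [hact₁, h₂]
      refine hc.tendsto.congr' ?_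
      filter_upwards [hdom] with q hq
      rw [hact₁, (hact₂ q.1 q.2 T hq).2]
    intro O hO
    have hO' := inter_mem hO ((isOpen_adapted_mSpace hf hK T).mem_nhds h₁)
    have himg := image_mem_map (m := fun m : MSpace f K => (m.1.1, momentum f T.1 m.1)) hO'
    rw [map_nhds_mSpace hf hK h₁] at himg
    have hev : ∀ᶠ q : (V →L[ℝ] ℝ) × MSpace f K in 𝓝 (g, m), _ := hlim himg
    change ∀ᶠ q : (V →L[ℝ] ℝ) × MSpace f K in 𝓝 (g, m), act q.1 q.2 ∈ O
    filter_upwards [hdom, hev] with q hq ⟨o, ⟨hoO, hoT⟩, hoq⟩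
    rw [← mSpace_ext_of_momentum hf hK hoT (hact₂ q.1 q.2 T hq).1 hoq]
    exact hoO
  continuous_proj := φ.continuous
  proj_act g m := by
    obtain ⟨T, hT⟩ := exists_tope_isAdapted hK m.2.1 m.2.2
    rw [hφ m T hT, proj_eq_zMk_iff hf hK hφ]
    exact ⟨hact₁ g m, (hact₂ g m T hT).1⟩
  locTriv b := by
    obtain ⟨⟨v, T⟩, rfl⟩ := Quot.exists_rep b
    set U : Set (ZSpace f K) := Set.range fun v : K => Quot.mk (ZRel f K) (v, T) with hU
    have hmem : ∀ m, φ m ∈ U ↔ IsAdapted f m.1.1 m.1.2 T.1 := by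
      intro m
      constructor
      · rintro ⟨u, hu⟩
        exact ((proj_eq_zMk_iff hf hK hφ).1 hu.symm).2
      · exact fun h => ⟨_, (hφ m T h).symm⟩
    refine ⟨U, isOpen_range_zMk hf hK T, ⟨v, rfl⟩, ?_⟩
    let h₀ : (φ ⁻¹' U) → U × (V →L[ℝ] ℝ) := fun m => (⟨φ m.1, m.2⟩, momentum f T.1 m.1.1)
    let j : U × (V →L[ℝ] ℝ) → V × (V →L[ℝ] ℝ) := fun u => (Zproj f K u.1, u.2)
    have hj : Continuous j :=
      ((continuous_zProj.comp continuous_subtype_val).comp continuous_fst).prodMk continuous_snd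
    have hjinj : Function.Injective j := by
      rintro ⟨⟨_, u, rfl⟩, μ⟩ ⟨⟨_, u', rfl⟩, μ'⟩ h
      obtain ⟨h₁, h₂⟩ := Prod.mk.inj h
      obtain rfl : u = u' := Subtype.ext h₁
      obtain rfl : μ = μ' := h₂
      rfl
    have hjh : ∀ m, j (h₀ m) = (m.1.1.1, momentum f T.1 m.1.1) := fun m =>
      Prod.ext (zProj_proj hK hφ m.1) rfl
    have hinj : Function.Injective h₀ := fun m m' h => Subtype.ext <|
      mSpace_ext_of_momentum hf hK ((hmem _).1 m.2) ((hmem _).1 m'.2)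
        (by rw [← hjh, ← hjh, h])
    have hsurj : Function.Surjective h₀ := by
      rintro ⟨⟨_, u, rfl⟩, μ⟩
      obtain ⟨w, hw, hwμ⟩ :=
        exists_momentum_eq (T.2.ne_zero hf hK) (T.2.exists_isAdapted (u : V)) μ
      obtain ⟨m, hm⟩ := exists_mSpace_eq hf hK u.2 hw
      have hmT : IsAdapted f m.1.1 m.1.2 T.1 := by rw [hm]; exact hw
      refine ⟨⟨m, (hmem m).2 hmT⟩, hjinj ?_⟩
      rw [hjh]
      simp only [hm, hwμ]
      rfl
    have hcont : Continuous h₀ := by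
      refine ((φ.continuous.comp continuous_subtype_val).subtype_mk _).prodMk ?_
      refine continuous_iff_continuousAt.2 fun m => ?_
      exact ContinuousAt.comp (f := fun m : (φ ⁻¹' U) => (m.1.1 : V × V))
        (contDiffAt_momentum (T.2.ne_zero hf hK) ((hmem _).1 m.2)).continuousAt
        ((isOpenEmbedding_val_mSpace hf hK).continuous.comp continuous_subtype_val).continuousAt
    have hopen : IsOpenMap h₀ := by
      have hcomp : IsOpenMap (j ∘ h₀) := by
        refine IsOpenMap.of_nhds_le fun m => le_of_eq ?_
        have hm := map_nhds_mSpace hf hK ((hmem _).1 m.2)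
        rw [← ((isOpen_range_zMk hf hK T).preimage
          φ.continuous).isOpenEmbedding_subtypeVal.map_nhds_eq m, map_map] at hm
        rw [Function.comp_apply, hjh, ← hm]
        exact congrArg (fun F => map F (𝓝 m)) (funext fun m' => (hjh m').symm)
      intro O hO
      rw [← hjinj.preimage_image (h₀ '' O), ← Set.image_comp]
      exact (hcomp O hO).preimage hj
    refine ⟨(Equiv.ofBijective h₀ ⟨hinj, hsurj⟩).toHomeomorphOfContinuousOpen hcont hopen,
      fun m => rfl, fun g m hq => ?_⟩
    obtain ⟨h₁, h₂⟩ := hact₂ g m.1 T ((hmem _).1 m.2)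
    refine hjinj ((hjh ⟨_, hq⟩).trans ?_)
    refine Prod.ext ?_ h₂
    exact (hact₁ g m.1).trans (zProj_proj hK hφ m.1).symm

theorem exists_continuous_lift {X : Type*} [TopologicalSpace X] [CompactSpace X] [T2Space X]
    (g : C(X, ZSpace f K)) {A : Set X} (hA : IsClosed A) (ψ : C(X, V))
    (hψ : ∀ x ∈ A, ∃ m, φ m = g x ∧ m.1.2 = ψ x) :
    ∃ S : C(X, MSpace f K), (∀ x, φ (S x) = g x) ∧ ∀ x ∈ A, (S x).1.2 = ψ x := by
  let C : ZSpace f K → Set V := fun z => {w | ∃ m, φ m = z ∧ m.1.2 = w}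
  have hC : ∀ (v : K) (T : Topes f K),
      C (Quot.mk (ZRel f K) (v, T)) = {w | IsAdapted f v w T.1} := by
    intro v T
    ext w
    constructor
    · rintro ⟨m, hm, rfl⟩
      obtain ⟨h₁, h₂⟩ := (proj_eq_zMk_iff hf hK hφ).1 hm
      exact h₁ ▸ h₂
    · intro hw
      obtain ⟨m, hm⟩ := exists_mSpace_eq hf hK v.2 hw
      refine ⟨m, (proj_eq_zMk_iff hf hK hφ).2 ?_, by rw [hm]⟩
      rw [hm]
      exact ⟨rfl, hw⟩
  have hCconv : ∀ z, Convex ℝ (C z) := by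
    intro z
    obtain ⟨⟨v, T⟩, rfl⟩ := Quot.exists_rep z
    rw [hC]
    exact convex_isAdapted (T.2.ne_zero hf hK) _
  have hCne : ∀ z, (C z).Nonempty := by
    intro z
    obtain ⟨⟨v, T⟩, rfl⟩ := Quot.exists_rep z
    rw [hC]
    exact T.2.exists_isAdapted _
  have hCopen : ∀ x₀ (h : C(X, V)), h x₀ ∈ C (g x₀) → ∀ᶠ x in 𝓝 x₀, h x ∈ C (g x) := by
    intro x₀ h hx₀
    obtain ⟨⟨v, T⟩, hvT⟩ := Quot.exists_rep (g x₀)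
    have hU : ∀ᶠ x in 𝓝 x₀, g x ∈ Set.range fun v : K => Quot.mk (ZRel f K) (v, T) :=
      g.continuous.continuousAt.eventually ((isOpen_range_zMk hf hK T).mem_nhds ⟨v, hvT⟩)
    have hc : Continuous fun x => (Zproj f K (g x), h x) :=
      (continuous_zProj.comp g.continuous).prodMk h.continuous
    have hO : ∀ᶠ x in 𝓝 x₀, IsAdapted f (Zproj f K (g x)) (h x) T.1 := by
      refine hc.continuousAt.eventually
        ((isOpen_isAdapted (T.2.ne_zero hf hK)).mem_nhds ?_)
      rw [← hvT, hC] at hx₀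
      change IsAdapted f (Zproj f K (g x₀)) (h x₀) T.1
      rw [← hvT]
      exact hx₀
    filter_upwards [hU, hO] with x ⟨u, hu⟩ hx
    rw [← hu] at hx ⊢
    rw [hC]
    exact hx
  obtain ⟨w, hw⟩ := exists_continuous_forall_mem_convex_of_local
    (t := fun x => C (g x) ∩ {w | x ∈ A → w = ψ x}) (fun x => by
      refine (hCconv _).inter ?_
      by_cases hx : x ∈ A
      · simp [hx]
      · simp [hx, convex_univ])
    (fun x => by
      by_cases hx : x ∈ A
      · exact ⟨_, hCopen x ψ (hψ x hx), ψ, ψ.continuous.continuousOn,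
          fun y hy => ⟨hy, fun _ => rfl⟩⟩
      · obtain ⟨w₀, hw₀⟩ := hCne (g x)
        exact ⟨_, inter_mem (hCopen x (.const X w₀) hw₀) (hA.isOpen_compl.mem_nhds hx),
          fun _ => w₀, continuousOn_const, fun y hy => ⟨hy.1, fun h => absurd h hy.2⟩⟩)
  choose S hS₁ hS₂ using fun x => (hw x).1
  refine ⟨⟨S, ?_⟩, hS₁, fun x hx => (hS₂ x).trans ((hw x).2 hx)⟩
  rw [(isOpenEmbedding_val_mSpace hf hK).isInducing.continuous_iff]
  refine ((continuous_zProj.comp g.continuous).prodMk w.continuous).congr fun x => ?_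
  exact Prod.ext ((congrArg (Zproj f K) (hS₁ x)).symm.trans (zProj_proj hK hφ (S x)))
    (hS₂ x).symm

omit hf in
theorem mSpace_ext_of_proj {m m' : MSpace f K} (h₁ : φ m = φ m') (h₂ : m.1.2 = m'.1.2) :
    m = m' :=
  Subtype.ext (Prod.ext (by rw [← zProj_proj hK hφ m, h₁, zProj_proj hK hφ]) h₂)

theorem isWeakHomotopyEquiv_proj : IsWeakHomotopyEquiv φ := by
  have hsnd : Continuous fun m : MSpace f K => m.1.2 :=
    continuous_snd.comp (isOpenEmbedding_val_mSpace hf hK).continuous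
  refine ⟨⟨?_, ?_⟩, fun n x => ⟨?_, ?_⟩⟩
  · rintro ⟨m⟩ ⟨m'⟩ h
    obtain ⟨γ⟩ : Joined (φ m) (φ m') := Quotient.exact h
    obtain ⟨S, hS₁, hS₂⟩ := exists_continuous_lift hf hK hφ γ.toContinuousMap
      (A := {0, 1}) (Set.toFinite _).isClosed
      ⟨fun t : I => (1 - (t : ℝ)) • m.1.2 + (t : ℝ) • m'.1.2, by fun_prop⟩ (by
        rintro t (rfl | rfl)
        · exact ⟨m, by simp, by simp⟩
        · exact ⟨m', by simp, by simp⟩)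
    refine Quotient.sound ⟨⟨S, ?_, ?_⟩⟩
    · exact mSpace_ext_of_proj hK hφ ((hS₁ 0).trans γ.source) (by simpa using hS₂ 0 (by simp))
    · exact mSpace_ext_of_proj hK hφ ((hS₁ 1).trans γ.target) (by simpa using hS₂ 1 (by simp))
  · rintro ⟨z⟩
    obtain ⟨S, hS, -⟩ := exists_continuous_lift hf hK hφ (.const Unit z) isClosed_empty
      (.const Unit 0) (by simp)
    exact ⟨.mk (S ()), congrArg ZerothHomotopy.mk (hS ())⟩
  · rintro ⟨p⟩ ⟨q⟩ h
    obtain ⟨H⟩ : GenLoop.Homotopic _ _ := Quotient.exact h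
    have hp : Continuous fun y : I × (Fin n → I) => (p.1 y.2).1.2 :=
      hsnd.comp (p.1.continuous.comp continuous_snd)
    have hq : Continuous fun y : I × (Fin n → I) => (q.1 y.2).1.2 :=
      hsnd.comp (q.1.continuous.comp continuous_snd)
    have hA : IsClosed {y : I × (Fin n → I) | (y.1 = 0 ∨ y.1 = 1) ∨ y.2 ∈ Cube.boundary _} :=
      ((isClosed_eq continuous_fst continuous_const).union
        (isClosed_eq continuous_fst continuous_const)).union
        ((isClosed_cube_boundary _).preimage continuous_snd)
    have hHb : ∀ t, ∀ y ∈ Cube.boundary (Fin n), H (t, y) = φ x := fun t y hy =>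
      (H.eq_fst t hy).trans (congrArg φ (p.2 y hy))
    obtain ⟨S, hS₁, hS₂⟩ := exists_continuous_lift hf hK hφ H.toContinuousMap hA
      ⟨fun y => (1 - (y.1 : ℝ)) • (p.1 y.2).1.2 + (y.1 : ℝ) • (q.1 y.2).1.2, by fun_prop⟩ (by
        rintro ⟨t, y⟩ ((ht | ht) | hy)
        · obtain rfl : t = 0 := ht
          exact ⟨p.1 y, (H.apply_zero y).symm, by simp⟩
        · obtain rfl : t = 1 := ht
          exact ⟨q.1 y, (H.apply_one y).symm, by simp⟩
        · refine ⟨x, (hHb t y hy).symm, ?_⟩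
          simp only [ContinuousMap.coe_mk, p.2 y hy, q.2 y hy, ← add_smul, sub_add_cancel,
            one_smul])
    refine Quotient.sound ⟨⟨⟨S, fun y => ?_, fun y => ?_⟩, fun t y hy => ?_⟩⟩
    · exact mSpace_ext_of_proj hK hφ ((hS₁ (0, y)).trans (H.apply_zero y))
        (by simpa using hS₂ (0, y) (by simp))
    · exact mSpace_ext_of_proj hK hφ ((hS₁ (1, y)).trans (H.apply_one y))
        (by simpa using hS₂ (1, y) (by simp))
    · refine mSpace_ext_of_proj hK hφ ((hS₁ (t, y)).trans (H.eq_fst t hy)) ?_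
      refine (hS₂ (t, y) (Or.inr hy)).trans ?_
      simp only [ContinuousMap.coe_mk, p.2 y hy, q.2 y hy, ← add_smul, sub_add_cancel, one_smul]
  · rintro ⟨p⟩
    obtain ⟨S, hS₁, hS₂⟩ := exists_continuous_lift hf hK hφ p.1 (isClosed_cube_boundary _)
      (.const _ x.1.2)
      fun y hy => ⟨x, (p.2 y hy).symm, rfl⟩
    refine ⟨Quotient.mk _ ⟨S, fun y hy => ?_⟩, congrArg (Quotient.mk _) ?_⟩
    · exact mSpace_ext_of_proj hK hφ ((hS₁ y).trans (p.2 y hy)) (hS₂ y hy)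
    · exact Subtype.ext (ContinuousMap.ext hS₁)

end Bundle

end Adapted

variable {V : Type*} [NormedAddCommGroup V] [NormedSpace ℝ V] [FiniteDimensional ℝ V]
variable {E : Type*} [Fintype E]

/-- There is a canonical map `φ : M(A,K) → Z(A,K)` which is a principal bundle with
structure group `V* = V →L[ℝ] ℝ` and satisfies `π ∘ φ = ρ`; in particular `M(A,K)` is
weakly homotopy equivalent to `Z(A,K)`. -/
theorem complement_principal_bundle_over_Z_pair
    (f : E → (V →ᵃ[ℝ] ℝ)) (hf : ∀ e, (f e).linear ≠ 0)
    (K : Set V) (hKne : K.Nonempty) (hKconv : Convex ℝ K) (hKopen : IsOpen K) :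
    ∃ (act : (V →L[ℝ] ℝ) → MSpace f K → MSpace f K)
      (φ : C(MSpace f K, ZSpace f K)),
      IsAddPrincipalBundle (V →L[ℝ] ℝ) act ⇑φ ∧
      (∀ m : MSpace f K, Zproj f K (φ m) = Mproj f K m) ∧
      IsWeakHomotopyEquiv φ := by
  obtain ⟨φ, hφ⟩ := exists_continuousMap_zSpace (f := f) hf hKopen
  choose act hact₁ hact₂ using exists_translation (f := f) (K := K) hf hKopen
  exact ⟨act, φ, isAddPrincipalBundle_of_translation hf hKopen hφ hact₁ hact₂,
    zProj_proj hKopen hφ, isWeakHomotopyEquiv_proj hf hKopen hφ⟩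
end

section
/- For any conditional oriented matroid L, the order complex |L| of the poset of covectors of L (ordered by X ≤ Y iff X∘Y = Y) is contractible. -/
/-- `L` is a conditional oriented matroid: it is nonempty, closed under composition with
negation, and satisfies the elimination axiom. -/
def IsCOM {E : Type*} (L : Set (E → SignType)) : Prop :=
  L.Nonempty ∧
    (∀ X ∈ L, ∀ Y ∈ L, scomp X (-Y) ∈ L) ∧
    (∀ X ∈ L, ∀ Y ∈ L, ∀ e ∈ SepSet X Y,
      ∃ Z ∈ L, Z e = 0 ∧ ∀ f ∉ SepSet X Y, Z f = scomp X Y f)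

/-- `L` is an oriented matroid: a conditional oriented matroid containing the zero
sign vector. -/
def IsOM {E : Type*} (L : Set (E → SignType)) : Prop :=
  IsCOM L ∧ (0 : E → SignType) ∈ L

/-- A covector of `L`, i.e. an element of `L` regarded as a member of the poset of
covectors. -/
@[ext]
structure Cov {E : Type*} (L : Set (E → SignType)) where
  val : E → SignType
  mem : val ∈ L

/-- The poset of covectors, ordered by `X ≤ Y` iff `X ∘ Y = Y`. -/
instance {E : Type*} (L : Set (E → SignType)) : PartialOrder (Cov L) where
  le X Y := sle X.val Y.val
  le_refl X := sle_refl X.val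
  le_trans _ _ _ h₁ h₂ := sle_trans h₁ h₂
  le_antisymm _ _ h₁ h₂ := Cov.ext (sle_antisymm h₁ h₂)

open CategoryTheory in
/-- The order complex of a poset `P`: the geometric realization of the simplicial complex
whose simplices are the chains in `P` (implemented as the realization of the nerve of `P`,
which has the same homotopy type). -/
noncomputable def orderComplex (P : Type) [PartialOrder P] : TopCat :=
  SSet.toTop.obj (CategoryTheory.nerve P)

open scoped NNReal unitInterval

/-- The cone of nonzero nonnegative weights on a poset that are supported on a chain. -/
abbrev ChainCone (P : Type) [PartialOrder P] : Type :=
  {w : P → ℝ≥0 // w ≠ 0 ∧ ∀ p q, w p ≠ 0 → w q ≠ 0 → p ≤ q ∨ q ≤ p}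

namespace ChainCone

section Basic

variable {P : Type} [PartialOrder P]

theorem continuous_val : Continuous (fun w : ChainCone P => w.1) := continuous_subtype_val

/-- Two maps into a chain cone whose supports are pointwise comparable are homotopic. -/
theorem homotopic_of_comparable {Z : Type} [TopologicalSpace Z] (F G : C(Z, ChainCone P))
    (h : ∀ z p q, (F z).1 p ≠ 0 → (G z).1 q ≠ 0 → p ≤ q ∨ q ≤ p) : F.Homotopic G := by
  have hF : Continuous fun z => (F z).1 := continuous_val.comp F.continuous
  have hG : Continuous fun z => (G z).1 := continuous_val.comp G.continuous
  refine ⟨⟨⟨fun x => ⟨fun p => unitInterval.toNNReal (unitInterval.symm x.1) * (F x.2).1 p +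
      unitInterval.toNNReal x.1 * (G x.2).1 p, ?_, ?_⟩, ?_⟩, ?_, ?_⟩⟩
  · intro h0
    by_cases hx : unitInterval.toNNReal x.1 = 0
    · have hx' : x.1 = 0 := by
        apply Subtype.ext
        exact congrArg NNReal.toReal hx
      obtain ⟨p, hp⟩ := Function.ne_iff.1 (F x.2).2.1
      have := congrFun h0 p
      simp [hx'] at this
      exact hp this
    · obtain ⟨p, hp⟩ := Function.ne_iff.1 (G x.2).2.1
      have := congrFun h0 p
      simp only [Pi.zero_apply, add_eq_zero, mul_eq_zero] at this
      exact this.2.elim hx hp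
  · intro p q hp hq
    have key : ∀ r, unitInterval.toNNReal (unitInterval.symm x.1) * (F x.2).1 r +
        unitInterval.toNNReal x.1 * (G x.2).1 r ≠ 0 → (F x.2).1 r ≠ 0 ∨ (G x.2).1 r ≠ 0 := by
      intro r hr
      by_contra! hc
      exact hr (by simp [hc.1, hc.2])
    rcases key p hp with hp | hp <;> rcases key q hq with hq | hq
    · exact (F x.2).2.2 p q hp hq
    · exact h x.2 p q hp hq
    · exact (h x.2 q p hq hp).symm
    · exact (G x.2).2.2 p q hp hq
  · refine Continuous.subtype_mk (continuous_pi fun p => ?_) _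
    have h1 : Continuous fun x : I × Z => (F x.2).1 p :=
      (continuous_apply p).comp (hF.comp continuous_snd)
    have h2 : Continuous fun x : I × Z => (G x.2).1 p :=
      (continuous_apply p).comp (hG.comp continuous_snd)
    have h3 : Continuous fun x : I × Z => unitInterval.toNNReal x.1 :=
      unitInterval.toNNReal_continuous.comp continuous_fst
    have h4 : Continuous fun x : I × Z => unitInterval.toNNReal (unitInterval.symm x.1) :=
      unitInterval.toNNReal_continuous.comp (unitInterval.continuous_symm.comp continuous_fst)
    exact (h4.mul h1).add (h3.mul h2)
  · intro z
    apply Subtype.ext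
    funext p
    simp
  · intro z
    apply Subtype.ext
    funext p
    simp

/-- The chain cone of a one-point poset is contractible. -/
theorem contractibleSpace_of_unique [Unique P] : ContractibleSpace (ChainCone P) := by
  let w₀ : ChainCone P := ⟨fun _ => 1, fun h => one_ne_zero (congrFun h default),
    fun p q _ _ => Or.inl (Subsingleton.elim p q).le⟩
  rw [contractible_iff_id_nullhomotopic]
  exact ⟨w₀, homotopic_of_comparable _ _ fun _ p q _ _ => Or.inl (Subsingleton.elim p q).le⟩

theorem exists_greatest {c : Finset P} (hne : c.Nonempty)
    (hc : IsChain (· ≤ ·) (c : Set P)) : ∃ m, IsGreatest (c : Set P) m := by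
  obtain ⟨m, hm⟩ := c.exists_maximal hne
  refine ⟨m, hm.1, fun x hx => ?_⟩
  rcases eq_or_ne x m with rfl | hxm
  · exact le_rfl
  · exact (hc hx hm.1 hxm).elim id fun h => hm.2 hx h

end Basic

section Sweep

variable {P Q M : Type}

/-- The least weight on a finset (and `0` on the empty finset). -/
noncomputable def low (w : P → ℝ≥0) (c : Finset P) : ℝ≥0 :=
  if h : c.Nonempty then c.inf' h w else 0

theorem continuous_low (c : Finset P) : Continuous fun w : P → ℝ≥0 => low w c := by
  unfold low
  split_ifs with h
  · exact Continuous.finset_inf'_apply h fun p _ => continuous_apply p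
  · exact continuous_const

variable [Fintype P]

/-- The superlevel sets of a weight. -/
noncomputable def level (w : P → ℝ≥0) (t : ℝ≥0) : Finset P := Finset.univ.filter (t ≤ w ·)

theorem mem_level {w : P → ℝ≥0} {t : ℝ≥0} {p : P} : p ∈ level w t ↔ t ≤ w p := by
  simp [level]

theorem level_anti (w : P → ℝ≥0) {s t : ℝ≥0} (h : s ≤ t) : level w t ⊆ level w s :=
  fun _ hp => mem_level.2 (h.trans (mem_level.1 hp))

theorem continuous_sup : Continuous fun w : P → ℝ≥0 => Finset.univ.sup w :=
  Continuous.finset_sup_apply fun p _ => continuous_apply p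

theorem low_le_sup (w : P → ℝ≥0) (c : Finset P) : low w c ≤ Finset.univ.sup w := by
  unfold low
  split_ifs with h
  · obtain ⟨p, hp⟩ := h
    exact (Finset.inf'_le w hp).trans (Finset.le_sup (Finset.mem_univ p))
  · exact zero_le

theorem isChain_level [PartialOrder P] (w : ChainCone P) {t : ℝ≥0} (ht : 0 < t) :
    IsChain (· ≤ ·) (level w.1 t : Set P) := by
  intro p hp q hq _
  exact w.2.2 p q (ht.trans_le (mem_level.1 hp)).ne' (ht.trans_le (mem_level.1 hq)).ne'

/-- Push a weight forward along a monotone map, taking suprema over fibres. -/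
noncomputable def supMap [PartialOrder P] [Fintype M] [DecidableEq M] [PartialOrder M]
    (π : P →o M) : C(ChainCone P, ChainCone M) where
  toFun w := ⟨fun m => (Finset.univ.filter (π · = m)).sup w.1, by
    obtain ⟨p, hp⟩ := Function.ne_iff.1 w.2.1
    refine Function.ne_iff.2 ⟨π p, ?_⟩
    have : w.1 p ≤ (Finset.univ.filter (π · = π p)).sup w.1 :=
      Finset.le_sup (by simp)
    exact ((pos_iff_ne_zero.2 hp).trans_le this).ne', by
    have key : ∀ m, (Finset.univ.filter (π · = m)).sup w.1 ≠ 0 → ∃ p, π p = m ∧ w.1 p ≠ 0 := by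
      intro m hm
      by_contra! hc
      apply hm
      refine (Finset.sup_eq_bot_iff _ _).2 ?_
      intro p hp
      exact hc p (by simpa using hp)
    intro m m' hm hm'
    obtain ⟨p, rfl, hp⟩ := key m hm
    obtain ⟨q, rfl, hq⟩ := key m' hm'
    exact (w.2.2 p q hp hq).imp (fun h => π.monotone h) (fun h => π.monotone h)⟩
  continuous_toFun := Continuous.subtype_mk (continuous_pi fun m =>
    Continuous.finset_sup_apply fun p _ => (continuous_apply p).comp continuous_val) _

theorem level_supMap [PartialOrder P] [Fintype M] [DecidableEq M] [PartialOrder M]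
    (π : P →o M) (w : ChainCone P) {t : ℝ≥0} (ht : 0 < t) :
    level (supMap π w).1 t = (level w.1 t).image π := by
  ext m
  rw [mem_level, Finset.mem_image]
  change t ≤ (Finset.univ.filter (π · = m)).sup w.1 ↔ _
  rw [Finset.le_sup_iff ht]
  simp only [Finset.mem_filter, Finset.mem_univ, true_and, mem_level]
  exact exists_congr fun p => and_comm

variable [DecidableEq P]

/-- The greatest weight outside of a finset. -/
noncomputable def high (w : P → ℝ≥0) (c : Finset P) : ℝ≥0 := cᶜ.sup w

theorem continuous_high (c : Finset P) : Continuous fun w : P → ℝ≥0 => high w c := by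
  unfold high
  exact Continuous.finset_sup_apply fun p _ => continuous_apply p

theorem eq_level {w : P → ℝ≥0} {c : Finset P} {t : ℝ≥0} (h1 : high w c < t) (h2 : t ≤ low w c) :
    c.Nonempty ∧ c = level w t := by
  have hc : c.Nonempty := by
    by_contra hc
    rw [low, dif_neg hc] at h2
    exact absurd (h1.trans_le h2) not_lt_zero
  refine ⟨hc, ?_⟩
  rw [low, dif_pos hc] at h2
  ext p
  rw [mem_level]
  refine ⟨fun hp => h2.trans (Finset.inf'_le w hp), fun hp => ?_⟩
  by_contra hpc
  have : w p ≤ high w c := Finset.le_sup (Finset.mem_compl.2 hpc)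
  exact absurd (hp.trans this) (not_le.2 h1)

variable [DecidableEq Q]

/-- Push a weight forward along its superlevel sets, using `φ` for the levels below `S` and
`ψ` for the levels above `S`. -/
noncomputable def sweep (φ ψ : Finset P → Q) (w : P → ℝ≥0) (S : ℝ≥0) (q : Q) : ℝ≥0 :=
  ∑ c, ((if φ c = q then min (low w c) S - high w c else 0) +
    (if ψ c = q then low w c - max S (high w c) else 0))

theorem exists_level_of_sweep_ne_zero {φ ψ : Finset P → Q} {w : P → ℝ≥0} {S : ℝ≥0} {q : Q}
    (h : sweep φ ψ w S q ≠ 0) :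
    ∃ t, 0 < t ∧ (level w t).Nonempty ∧
      (t ≤ S ∧ φ (level w t) = q ∨ S < t ∧ ψ (level w t) = q) := by
  obtain ⟨c, -, hc⟩ := Finset.exists_ne_zero_of_sum_ne_zero h
  by_cases h1 : φ c = q ∧ high w c < min (low w c) S
  · obtain ⟨hne, heq⟩ := eq_level h1.2 (min_le_left _ _)
    exact ⟨_, zero_le.trans_lt h1.2, heq ▸ hne, Or.inl ⟨min_le_right _ _, heq ▸ h1.1⟩⟩
  · have h0 : (if φ c = q then min (low w c) S - high w c else 0) = 0 := by
      split_ifs with h2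
      · exact tsub_eq_zero_of_le (not_lt.1 fun h3 => h1 ⟨h2, h3⟩)
      · rfl
    rw [h0, zero_add] at hc
    split_ifs at hc with h2
    · have h3 : max S (high w c) < low w c := tsub_pos_iff_lt.1 (pos_iff_ne_zero.2 hc)
      obtain ⟨hne, heq⟩ := eq_level ((le_max_right _ _).trans_lt h3) le_rfl
      exact ⟨_, zero_le.trans_lt h3, heq ▸ hne,
        Or.inr ⟨(le_max_left _ _).trans_lt h3, heq ▸ h2⟩⟩
    · exact absurd rfl hc

theorem sweep_ne_zero (φ ψ : Finset P → Q) {w : P → ℝ≥0} (hw : w ≠ 0) (S : ℝ≥0) :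
    sweep φ ψ w S ≠ 0 := by
  obtain ⟨p₀, hp₀⟩ := Function.ne_iff.1 hw
  have : Nonempty P := ⟨p₀⟩
  obtain ⟨p, -, hp⟩ := Finset.exists_mem_eq_sup Finset.univ Finset.univ_nonempty w
  set m := Finset.univ.sup w with hm
  have hm0 : 0 < m := (pos_iff_ne_zero.2 hp₀).trans_le (Finset.le_sup (Finset.mem_univ p₀))
  have hlow : m ≤ low w (level w m) := by
    have hne : (level w m).Nonempty := ⟨p, mem_level.2 hp.le⟩
    rw [low, dif_pos hne]
    exact Finset.le_inf' _ _ fun x hx => mem_level.1 hx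
  have hhigh : high w (level w m) < m := by
    rw [high, Finset.sup_lt_iff hm0]
    intro x hx
    rw [Finset.mem_compl, mem_level] at hx
    exact not_le.1 hx
  intro h
  by_cases hS : high w (level w m) < S
  · have := (Finset.sum_eq_zero_iff.1 (congrFun h (φ (level w m)))) (level w m) (Finset.mem_univ _)
    rw [if_pos rfl, add_eq_zero, tsub_eq_zero_iff_le] at this
    exact absurd this.1 (not_le.2 (lt_min (hhigh.trans_le hlow) hS))
  · have := (Finset.sum_eq_zero_iff.1 (congrFun h (ψ (level w m)))) (level w m) (Finset.mem_univ _)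
    rw [if_pos rfl, add_eq_zero, tsub_eq_zero_iff_le] at this
    exact absurd this.2 (not_le.2 (max_lt ((not_lt.1 hS).trans_lt (hhigh.trans_le hlow))
      (hhigh.trans_le hlow)))

theorem continuous_sweep (φ ψ : Finset P → Q) :
    Continuous fun x : (P → ℝ≥0) × ℝ≥0 => sweep φ ψ x.1 x.2 := by
  refine continuous_pi fun q => continuous_finsetSum _ fun c _ => Continuous.add ?_ ?_
  · split_ifs
    · exact (((continuous_low c).comp continuous_fst).min continuous_snd).sub
        ((continuous_high c).comp continuous_fst)
    · exact continuous_const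
  · split_ifs
    · exact ((continuous_low c).comp continuous_fst).sub
        (continuous_snd.max ((continuous_high c).comp continuous_fst))
    · exact continuous_const

theorem sweep_zero (φ ψ : Finset P → Q) (w : P → ℝ≥0) : sweep φ ψ w 0 = sweep ψ ψ w 0 := by
  funext q
  simp [sweep]

theorem sweep_sup (φ ψ : Finset P → Q) (w : P → ℝ≥0) :
    sweep φ ψ w (Finset.univ.sup w) = sweep φ φ w 0 := by
  funext q
  refine Finset.sum_congr rfl fun c _ => ?_
  have h1 : min (low w c) (Finset.univ.sup w) = low w c := min_eq_left (low_le_sup w c)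
  have h2 : low w c - max (Finset.univ.sup w) (high w c) = 0 :=
    tsub_eq_zero_of_le ((low_le_sup w c).trans (le_max_left _ _))
  simp [h1, h2]

variable [PartialOrder P] [PartialOrder Q] [Fintype M] [DecidableEq M] [PartialOrder M]

/-- A map on finsets that is monotone on nonempty chains. -/
def ChainMono (φ : Finset P → Q) : Prop :=
  ∀ c c' : Finset P, c.Nonempty → c ⊆ c' → IsChain (· ≤ ·) (c' : Set P) → φ c ≤ φ c'

theorem sweep_chain {φ ψ : Finset P → Q} (hφ : ChainMono φ) (hψ : ChainMono ψ)
    (hle : ∀ c : Finset P, c.Nonempty → IsChain (· ≤ ·) (c : Set P) → ψ c ≤ φ c)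
    (w : ChainCone P) (S : ℝ≥0) (p q : Q) (hp : sweep φ ψ w.1 S p ≠ 0)
    (hq : sweep φ ψ w.1 S q ≠ 0) : p ≤ q ∨ q ≤ p := by
  obtain ⟨t, ht, hne, h⟩ := exists_level_of_sweep_ne_zero hp
  obtain ⟨t', ht', hne', h'⟩ := exists_level_of_sweep_ne_zero hq
  have mono : ∀ {χ : Finset P → Q}, ChainMono χ →
      χ (level w.1 t) ≤ χ (level w.1 t') ∨ χ (level w.1 t') ≤ χ (level w.1 t) := by
    intro χ hχ
    rcases le_total t t' with htt | htt
    · exact Or.inr (hχ _ _ hne' (level_anti _ htt) (isChain_level w ht))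
    · exact Or.inl (hχ _ _ hne (level_anti _ htt) (isChain_level w ht'))
  rcases h with ⟨hS, rfl⟩ | ⟨hS, rfl⟩ <;> rcases h' with ⟨hS', rfl⟩ | ⟨hS', rfl⟩
  · exact mono hφ
  · exact Or.inr ((hle _ hne' (isChain_level w ht')).trans
      (hφ _ _ hne' (level_anti _ (hS.trans hS'.le)) (isChain_level w ht)))
  · exact Or.inl ((hle _ hne (isChain_level w ht)).trans
      (hφ _ _ hne (level_anti _ (hS'.trans hS.le)) (isChain_level w ht')))
  · exact mono hψ

/-- The map of chain cones induced by a map on finsets that is monotone on chains. -/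
noncomputable def push (φ : Finset P → Q) (hφ : ChainMono φ) : C(ChainCone P, ChainCone Q) where
  toFun w := ⟨sweep φ φ w.1 0, sweep_ne_zero φ φ w.2.1 0,
    sweep_chain hφ hφ (fun _ _ _ => le_rfl) w 0⟩
  continuous_toFun := Continuous.subtype_mk
    ((continuous_sweep φ φ).comp (continuous_val.prodMk continuous_const)) _

theorem exists_level_of_push_ne_zero {φ : Finset P → Q} (hφ : ChainMono φ) {w : ChainCone P} {q : Q}
    (h : (push φ hφ w).1 q ≠ 0) :
    ∃ t, 0 < t ∧ (level w.1 t).Nonempty ∧ φ (level w.1 t) = q := by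
  obtain ⟨t, ht, hne, h⟩ := exists_level_of_sweep_ne_zero h
  exact ⟨t, ht, hne, h.elim And.right And.right⟩

theorem push_homotopic {φ ψ : Finset P → Q} (hφ : ChainMono φ) (hψ : ChainMono ψ)
    (hle : ∀ c : Finset P, c.Nonempty → IsChain (· ≤ ·) (c : Set P) → ψ c ≤ φ c) :
    (push ψ hψ).Homotopic (push φ hφ) := by
  refine ⟨⟨⟨fun x => ⟨sweep φ ψ x.2.1 (unitInterval.toNNReal x.1 * Finset.univ.sup x.2.1),
    sweep_ne_zero φ ψ x.2.2.1 _, sweep_chain hφ hψ hle x.2 _⟩, ?_⟩, ?_, ?_⟩⟩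
  · refine Continuous.subtype_mk ((continuous_sweep φ ψ).comp
      ((continuous_val.comp continuous_snd).prodMk ?_)) _
    exact (unitInterval.toNNReal_continuous.comp continuous_fst).mul
      (continuous_sup.comp (continuous_val.comp continuous_snd))
  · intro w
    apply Subtype.ext
    simpa using! sweep_zero φ ψ w.1
  · intro w
    apply Subtype.ext
    simpa using! sweep_sup φ ψ w.1

/-- If `s` is monotone on nonempty chains and `s ∘ π` lies below the maximum of a chain, then the
contractibility of the chain cone passes from the target of `π` to its source. -/
theorem contractibleSpace_of_section (π : P →o M) (s : Finset M → P) (hs : ChainMono s)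
    (hle : ∀ (c : Finset P) (m : P), IsChain (· ≤ ·) (c : Set P) → IsGreatest (c : Set P) m →
      s (c.image π) ≤ m) [hM : ContractibleSpace (ChainCone M)] :
    ContractibleSpace (ChainCone P) := by
  classical
  have hP : Nonempty P := ⟨s ∅⟩
  obtain ⟨top, htop⟩ : ∃ top : Finset P → P, ∀ c : Finset P, c.Nonempty →
      IsChain (· ≤ ·) (c : Set P) → IsGreatest (c : Set P) (top c) := by
    refine ⟨fun c => if h : ∃ m, IsGreatest (c : Set P) m then h.choose else hP.some,
      fun c hne hc => ?_⟩
    have h := exists_greatest hne hc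
    simpa only [dif_pos h] using h.choose_spec
  have htop_mono : ChainMono top := fun c c' hne hcc hc' =>
    (htop c' (hne.mono hcc) hc').2 (hcc (htop c hne (hc'.mono hcc)).1)
  have hchain : ∀ c : Finset P, IsChain (· ≤ ·) (c : Set P) →
      IsChain (· ≤ ·) ((c.image π : Finset M) : Set M) := by
    intro c hc
    rw [Finset.coe_image]
    rintro _ ⟨p, hp, rfl⟩ _ ⟨q, hq, rfl⟩ hpq
    exact (hc hp hq fun h => hpq (congrArg π h)).imp (fun h => π.monotone h) fun h => π.monotone h
  have hsπ : ChainMono fun c : Finset P => s (c.image π) := fun c c' hne hcc hc' =>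
    hs _ _ (hne.image π) (Finset.image_subset_image hcc) (hchain c' hc')
  have h1 : (ContinuousMap.id _).Homotopic (push top htop_mono) := by
    refine homotopic_of_comparable _ _ fun w p q hp hq => ?_
    obtain ⟨t, ht, hne, rfl⟩ := exists_level_of_push_ne_zero htop_mono hq
    have := mem_level.1 (htop _ hne (isChain_level w ht)).1
    exact w.2.2 _ _ hp (ht.trans_le this).ne'
  have h2 : (push _ hsπ).Homotopic (push top htop_mono) :=
    push_homotopic htop_mono hsπ fun c hne hc => hle c _ hc (htop c hne hc)
  have h3 : (push _ hsπ).Homotopic ((push s hs).comp (supMap π)) := by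
    refine homotopic_of_comparable _ _ fun w p q hp hq => ?_
    obtain ⟨t, ht, hne, rfl⟩ := exists_level_of_push_ne_zero hsπ hp
    obtain ⟨t', ht', hne', rfl⟩ := exists_level_of_push_ne_zero hs hq
    rw [level_supMap π w ht'] at hne' ⊢
    rcases le_total t t' with htt | htt
    · exact Or.inr (hsπ _ _ hne'.of_image (level_anti _ htt) (isChain_level w ht))
    · exact Or.inl (hsπ _ _ hne (level_anti _ htt) (isChain_level w ht'))
  obtain ⟨y, hy⟩ := (contractible_iff_id_nullhomotopic _).1 hM
  rw [contractible_iff_id_nullhomotopic]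
  refine ⟨push s hs y, (h1.trans (h2.symm.trans h3)).trans ?_⟩
  have h4 := (ContinuousMap.Homotopic.refl (push s hs)).comp
    (hy.comp (ContinuousMap.Homotopic.refl (supMap π)))
  rwa [ContinuousMap.id_comp, ContinuousMap.const_comp, ContinuousMap.comp_const] at h4

end Sweep
end ChainCone

section COM

variable {E : Type}

theorem sle_iff {X Y : E → SignType} : sle X Y ↔ ∀ f, X f = 0 ∨ X f = Y f := by
  refine ⟨fun h f => ?_, fun h => funext fun f => ?_⟩
  · have hf := congrFun h f
    simp only [scomp] at hf
    split_ifs at hf with h0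
    · exact Or.inl h0
    · exact Or.inr hf
  · simp only [scomp]
    split_ifs with h0
    · rfl
    · exact (h f).resolve_left h0

theorem SignType.eq_zero_or_opposite {a b : SignType} (h : a ≠ b) :
    a = 0 ∨ b = 0 ∨ (a = 1 ∧ b = -1 ∨ a = -1 ∧ b = 1) := by
  revert a b; decide

theorem IsCOM.scomp_mem {L : Set (E → SignType)} (hL : IsCOM L) {X Y : E → SignType}
    (hX : X ∈ L) (hY : Y ∈ L) : scomp X Y ∈ L := by
  have h := hL.2.1 X hX _ (hL.2.1 X hX Y hY)
  convert h using 1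
  funext f
  by_cases h0 : X f = 0 <;> simp [scomp, h0]

theorem Cov.le_iff {L : Set (E → SignType)} {X Y : Cov L} : X ≤ Y ↔ sle X.val Y.val := Iff.rfl

variable [DecidableEq E]

/-- The deletion of a coordinate, realised by setting that coordinate to zero. -/
def deletion (e : E) (L : Set (E → SignType)) : Set (E → SignType) :=
  (fun X => Function.update X e 0) '' L

theorem isCOM_deletion {L : Set (E → SignType)} (hL : IsCOM L) (e : E) :
    IsCOM (deletion e L) := by
  refine ⟨hL.1.image _, ?_, ?_⟩
  · rintro _ ⟨X, hX, rfl⟩ _ ⟨Y, hY, rfl⟩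
    refine ⟨_, hL.2.1 X hX Y hY, ?_⟩
    funext f
    by_cases h : f = e
    · subst h; simp [scomp]
    · simp [scomp, h]
  · rintro _ ⟨X, hX, rfl⟩ _ ⟨Y, hY, rfl⟩ f hf
    have hfe : f ≠ e := by
      rintro rfl
      simp [SepSet] at hf
    have hf' : f ∈ SepSet X Y := by simpa [SepSet, hfe] using hf
    obtain ⟨Z, hZ, hZf, h⟩ := hL.2.2 X hX Y hY f hf'
    refine ⟨_, ⟨Z, hZ, rfl⟩, by simp [hfe, hZf], fun g hg => ?_⟩
    by_cases hge : g = e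
    · subst hge; simp [scomp]
    · have hg' : g ∉ SepSet X Y := by simpa [SepSet, hge] using hg
      simpa [scomp, hge] using h g hg'

/-- The sign `a` is forced at `Y` in direction `e`: the vector `Y` lifts to `L` with sign `a`
at `e`, but not with sign zero. -/
def ForcedSign (L : Set (E → SignType)) (e : E) (Y : E → SignType) (a : SignType) : Prop :=
  Function.update Y e a ∈ L ∧ Function.update Y e 0 ∉ L

theorem IsCOM.update_mem_of_sle {L : Set (E → SignType)} (hL : IsCOM L) {e : E}
    {Y X : E → SignType} {a : SignType} (hY : ForcedSign L e Y a) (hX : X ∈ L)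
    (h : sle (Function.update Y e 0) (Function.update X e 0)) : Function.update X e a ∈ L := by
  have ha : a ≠ 0 := by
    rintro rfl
    exact hY.2 hY.1
  convert hL.scomp_mem hY.1 hX using 1
  funext f
  by_cases hf : f = e
  · subst hf; simp [scomp, ha]
  · have := sle_iff.1 h f
    simp only [Function.update_of_ne hf] at this
    simp only [scomp, Function.update_of_ne hf]
    split_ifs with h0
    · rfl
    · exact (this.resolve_left h0).symm

theorem IsCOM.eq_of_forcedSign {L : Set (E → SignType)} (hL : IsCOM L) {e : E}
    {Y X : E → SignType} {a b : SignType} (hY : ForcedSign L e Y a) (hX : ForcedSign L e X b)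
    (h : sle (Function.update Y e 0) (Function.update X e 0)) : a = b := by
  have h1 : Function.update X e a ∈ L := by
    simpa using hL.update_mem_of_sle (X := Function.update X e b) hY hX.1 (by simpa using h)
  by_contra hab
  rcases SignType.eq_zero_or_opposite hab with rfl | rfl | hsep
  · exact hY.2 hY.1
  · exact hX.2 hX.1
  · have hsub : ∀ f, f ≠ e → f ∉ SepSet (Function.update X e a) (Function.update X e b) := by
      intro f hf
      simp only [SepSet, Set.mem_ofPred_eq, Function.update_of_ne hf]
      generalize X f = c
      revert c; decide
    obtain ⟨Z, hZ, hZe, hZf⟩ := hL.2.2 _ h1 _ hX.1 e (by simpa [SepSet] using hsep)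
    apply hX.2
    convert hZ using 1
    funext f
    by_cases hf : f = e
    · subst hf; simp [hZe]
    · rw [hZf f (hsub f hf)]
      simp [scomp, hf]

/-- The projection of covectors onto the covectors of a deletion. -/
def deletionMap (L : Set (E → SignType)) (e : E) : Cov L →o Cov (deletion e L) where
  toFun X := ⟨Function.update X.val e 0, X.val, X.mem, rfl⟩
  monotone' X Y h := by
    rw [Cov.le_iff, sle_iff] at h ⊢
    intro f
    by_cases hf : f = e
    · subst hf; simp
    · simpa [hf] using h f

@[simp]
theorem deletionMap_val (L : Set (E → SignType)) (e : E) (X : Cov L) :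
    (deletionMap L e X).val = Function.update X.val e 0 := rfl

/-- A covector of `L` is a canonical lift of a chain of covectors of the deletion if it lies over
the maximum of the chain, and its sign at `e` is the one forced by some member of the chain, or
zero if nothing is forced. -/
def IsLift (L : Set (E → SignType)) (e : E) (d : Finset (Cov (deletion e L))) (X : Cov L) : Prop :=
  IsGreatest (d : Set (Cov (deletion e L))) (deletionMap L e X) ∧
    (∀ y ∈ d, ∀ a, ForcedSign L e y.val a → X.val e = a) ∧
    ((∀ y ∈ d, ∀ a, ¬ ForcedSign L e y.val a) → X.val e = 0)

theorem update_self_of_mem_deletion {L : Set (E → SignType)} {e : E} {Y : E → SignType}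
    (hY : Y ∈ deletion e L) : Function.update Y e 0 = Y := by
  obtain ⟨X, -, rfl⟩ := hY
  simp

theorem IsCOM.exists_isLift {L : Set (E → SignType)} (hL : IsCOM L) {e : E}
    {d : Finset (Cov (deletion e L))} (hne : d.Nonempty)
    (hd : IsChain (· ≤ ·) (d : Set (Cov (deletion e L)))) : ∃ X, IsLift L e d X := by
  obtain ⟨m, hm⟩ := ChainCone.exists_greatest hne hd
  obtain ⟨X, hX, hXm⟩ := m.mem
  have hXm : Function.update X e 0 = m.val := hXm
  have hm' : ∀ (a) (h : Function.update X e a ∈ L), deletionMap L e ⟨_, h⟩ = m := by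
    intro a h
    apply Cov.ext
    simpa using hXm
  by_cases hf : ∃ y ∈ d, ∃ a, ForcedSign L e y.val a
  · obtain ⟨y, hy, a, ha⟩ := hf
    have hmem : Function.update X e a ∈ L := by
      refine hL.update_mem_of_sle ha hX ?_
      rw [update_self_of_mem_deletion y.mem, hXm]
      exact hm.2 hy
    refine ⟨⟨_, hmem⟩, by rwa [hm' a hmem], fun y' hy' a' ha' => ?_, fun h => ?_⟩
    · simp only [Function.update_self]
      have h1 := update_self_of_mem_deletion y.mem
      have h2 := update_self_of_mem_deletion y'.mem
      rcases hd.total hy hy' with h | h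
      · exact hL.eq_of_forcedSign ha ha' (by rw [h1, h2]; exact h)
      · exact (hL.eq_of_forcedSign ha' ha (by rw [h1, h2]; exact h)).symm
    · exact absurd ha (h y hy a)
  · push Not at hf
    have hmem : Function.update X e 0 ∈ L := by
      by_contra h0
      refine hf m hm.1 (X e) ⟨?_, ?_⟩
      · rw [← hXm]; simpa using hX
      · rw [update_self_of_mem_deletion m.mem, ← hXm]; exact h0
    exact ⟨⟨_, hmem⟩, by rwa [hm' 0 hmem], fun y hy a ha => absurd ha (hf y hy a), fun _ => by simp⟩

theorem IsLift.le {L : Set (E → SignType)} {e : E} {d d' : Finset (Cov (deletion e L))}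
    {X X' : Cov L} (h : IsLift L e d X) (hle : deletionMap L e X ≤ deletionMap L e X')
    (he : ∀ y ∈ d, ∀ a, ForcedSign L e y.val a → X'.val e = a) : X ≤ X' := by
  rw [Cov.le_iff, sle_iff] at hle ⊢
  intro f
  by_cases hf : f = e
  · subst hf
    by_cases hd : ∃ y ∈ d, ∃ a, ForcedSign L f y.val a
    · obtain ⟨y, hy, a, ha⟩ := hd
      exact Or.inr ((h.2.1 y hy a ha).trans (he y hy a ha).symm)
    · push Not at hd
      exact Or.inl (h.2.2 hd)
  · simpa [hf] using hle f

instance [Finite E] (L : Set (E → SignType)) : Finite (Cov L) :=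
  Finite.of_injective Cov.val fun _ _ => Cov.ext

theorem IsCOM.contractibleSpace_of_deletion [Finite E] {L : Set (E → SignType)} (hL : IsCOM L)
    (e : E) (h : ContractibleSpace (ChainCone (Cov (deletion e L)))) :
    ContractibleSpace (ChainCone (Cov L)) := by
  classical
  have := Fintype.ofFinite (Cov L)
  have := Fintype.ofFinite (Cov (deletion e L))
  obtain ⟨X₀, hX₀⟩ := hL.1
  obtain ⟨s, hs⟩ : ∃ s : Finset (Cov (deletion e L)) → Cov L,
      ∀ d : Finset (Cov (deletion e L)), d.Nonempty →
      IsChain (· ≤ ·) (d : Set (Cov (deletion e L))) → IsLift L e d (s d) := by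
    refine ⟨fun d => if hd : ∃ X, IsLift L e d X then hd.choose else ⟨X₀, hX₀⟩, fun d hne hd => ?_⟩
    have h := hL.exists_isLift hne hd
    simpa only [dif_pos h] using h.choose_spec
  refine ChainCone.contractibleSpace_of_section (deletionMap L e) s ?_ ?_
  · intro d d' hne hsub hd'
    have h1 := hs d hne (hd'.mono hsub)
    have h2 := hs d' (hne.mono hsub) hd'
    exact h1.le (d' := d') (h2.1.2 (hsub h1.1.1)) fun y hy a ha => h2.2.1 y (hsub hy) a ha
  · intro c m hc hm
    have hchain : IsChain (· ≤ ·)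
        ((c.image (deletionMap L e) : Finset _) : Set (Cov (deletion e L))) := by
      rw [Finset.coe_image]
      rintro _ ⟨p, hp, rfl⟩ _ ⟨q, hq, rfl⟩ -
      exact (hc.total hp hq).imp (fun h => (deletionMap L e).monotone h)
        fun h => (deletionMap L e).monotone h
    have h1 := hs _ (Finset.Nonempty.image ⟨m, hm.1⟩ _) hchain
    refine h1.le (d' := c.image (deletionMap L e)) ?_ ?_
    · obtain ⟨p, hp, hpe⟩ := Finset.mem_image.1 h1.1.1
      rw [← hpe]
      exact (deletionMap L e).monotone (hm.2 hp)
    · intro y hy a ha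
      obtain ⟨x, hx, rfl⟩ := Finset.mem_image.1 hy
      have hxa : x.val e = a := by
        refine (hL.eq_of_forcedSign ha (X := (deletionMap L e x).val) ⟨?_, ha.2⟩ (sle_refl _)).symm
        simpa using x.mem
      have ha0 : a ≠ 0 := by
        rintro rfl
        exact ha.2 ha.1
      exact ((sle_iff.1 (hm.2 hx) e).resolve_left (by rwa [hxa])).symm.trans hxa

theorem IsCOM.contractibleSpace_chainCone [Finite E] {L : Set (E → SignType)} (hL : IsCOM L)
    (S : Finset E) (hS : ∀ X ∈ L, ∀ e ∉ S, X e = 0) : ContractibleSpace (ChainCone (Cov L)) := by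
  induction S using Finset.induction_on generalizing L with
  | empty =>
    obtain ⟨X₀, hX₀⟩ := hL.1
    have : Unique (Cov L) := ⟨⟨⟨X₀, hX₀⟩⟩, fun X => Cov.ext (funext fun e => by
      rw [hS _ X.mem e (Finset.notMem_empty e)]
      exact (hS X₀ hX₀ e (Finset.notMem_empty e)).symm)⟩
    exact ChainCone.contractibleSpace_of_unique
  | insert e S _ ih =>
    refine hL.contractibleSpace_of_deletion e (ih (isCOM_deletion hL e) ?_)
    rintro _ ⟨X, hX, rfl⟩ f hf
    by_cases hfe : f = e
    · subst hfe; simp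
    · simpa [hfe] using hS X hX f (by simp [hfe, hf])

end COM

section Realization

open CategoryTheory Simplicial Opposite

/-- The characteristic map of a simplex of a simplicial set in its geometric realization. -/
noncomputable def characteristicMap (X : SSet.{0}) {n : ℕ} (a : X _⦋n⦌) :
    C(stdSimplex ℝ (Fin (n + 1)), |X|) :=
  TopCat.toSSetObjEquiv _ _ ((sSetTopAdj.homEquiv X |X| (𝟙 |X|)).app (op ⦋n⦌) a)

theorem characteristicMap_map (X : SSet.{0}) {n m : ℕ} (f : ⦋n⦌ ⟶ ⦋m⦌) (a : X _⦋m⦌)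
    (t : stdSimplex ℝ (Fin (n + 1))) :
    characteristicMap X (X.map f.op a) t = characteristicMap X a (stdSimplex.map f t) := by
  rw [characteristicMap, NatTrans.naturality_apply]
  rfl

theorem toTop_map_characteristicMap {X : SSet.{0}} {T : TopCat.{0}} (f : |X| ⟶ T) {n : ℕ}
    (a : X _⦋n⦌) (t : stdSimplex ℝ (Fin (n + 1))) :
    f (characteristicMap X a t) =
      TopCat.toSSetObjEquiv _ _ ((sSetTopAdj.homEquiv X T f).app (op ⦋n⦌) a) t := by
  rw [← Category.id_comp f, Adjunction.homEquiv_naturality_right, Category.id_comp]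
  rfl

theorem toTop_hom_ext {X : SSet.{0}} {T : TopCat.{0}} {f g : |X| ⟶ T}
    (h : ∀ (n : ℕ) (a : X _⦋n⦌) t, f (characteristicMap X a t) = g (characteristicMap X a t)) :
    f = g := by
  apply (sSetTopAdj.homEquiv X T).injective
  ext ⟨n⟩ a
  induction n using SimplexCategory.rec with | _ n =>
  apply (TopCat.toSSetObjEquiv _ _).injective
  ext t
  exact (toTop_map_characteristicMap f a t).symm.trans
    ((h n a t).trans (toTop_map_characteristicMap g a t))

variable {P : Type} [PartialOrder P]

/-- The characteristic map of a chain in the order complex. -/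
noncomputable def chainMap {n : ℕ} (c : Fin (n + 1) →o P) :
    C(stdSimplex ℝ (Fin (n + 1)), |nerve P|) :=
  characteristicMap (nerve P) c.monotone.functor

theorem chainMap_comp {n m : ℕ} (c : Fin (m + 1) →o P) (f : Fin (n + 1) →o Fin (m + 1))
    (t : stdSimplex ℝ (Fin (n + 1))) :
    chainMap (c.comp f) t = chainMap c (stdSimplex.map f t) :=
  characteristicMap_map (nerve P) (SimplexCategory.Hom.mk f) c.monotone.functor t

theorem ChainCone.exists_range_eq_support [Fintype P] (w : ChainCone P) :
    ∃ (n : ℕ) (e : Fin (n + 1) →o P), Function.Injective e ∧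
      Function.support w.1 ⊆ Set.range e := by
  let S := {p : P // w.1 p ≠ 0}
  let _ : LinearOrder S :=
    { (inferInstance : PartialOrder S) with
      le_total p q := w.2.2 p q p.2 q.2
      toDecidableLE := Classical.decRel _ }
  obtain ⟨p, hp⟩ := Function.ne_iff.1 w.2.1
  have : Nonempty S := ⟨⟨p, hp⟩⟩
  obtain ⟨n, hn⟩ := Nat.exists_eq_succ_of_ne_zero (Fintype.card_ne_zero (α := S))
  let φ := monoEquivOfFin S hn
  refine ⟨n, ⟨fun i => (φ i).1, fun i j h => φ.monotone h⟩, ?_, ?_⟩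
  · exact Subtype.val_injective.comp φ.injective
  · intro q hq
    exact ⟨φ.symm ⟨q, hq⟩, congrArg Subtype.val (φ.apply_symm_apply ⟨q, hq⟩)⟩

theorem ChainCone.sum_pos [Fintype P] (w : ChainCone P) : 0 < ∑ p, w.1 p := by
  obtain ⟨p, hp⟩ := Function.ne_iff.1 w.2.1
  exact Finset.sum_pos' (fun _ _ => zero_le) ⟨p, Finset.mem_univ p, pos_of_ne_zero hp⟩

/-- The normalised barycentric coordinates of a weight supported on a given chain. -/
noncomputable def chainCoords [Fintype P] {n : ℕ} {e : Fin (n + 1) →o P} (he : Function.Injective e)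
    (w : {w : ChainCone P // Function.support w.1 ⊆ Set.range e}) :
    stdSimplex ℝ (Fin (n + 1)) :=
  ⟨fun i => ((w.1.1 (e i) / ∑ p, w.1.1 p : ℝ≥0) : ℝ), fun i => NNReal.coe_nonneg _, by
    have h : ∑ i, w.1.1 (e i) = ∑ p, w.1.1 p := by
      refine Finset.sum_of_injOn e he.injOn (by simp) (fun p _ hp => ?_) fun _ _ => rfl
      by_contra h0
      exact hp (by simpa using w.2 h0)
    rw [← NNReal.coe_sum, ← Finset.sum_div, h, div_self w.1.sum_pos.ne', NNReal.coe_one]⟩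

theorem continuous_chainCoords [Fintype P] {n : ℕ} {e : Fin (n + 1) →o P}
    (he : Function.Injective e) : Continuous (chainCoords he) := by
  have hv : ∀ p, Continuous fun w : {w : ChainCone P // Function.support w.1 ⊆ Set.range e} =>
      w.1.1 p := fun p =>
    (continuous_apply p).comp (continuous_subtype_val.comp continuous_subtype_val)
  refine Continuous.subtype_mk (continuous_pi fun i => ?_) _
  exact NNReal.continuous_coe.comp
    ((hv _).div₀ (continuous_finsetSum _ fun p _ => hv p) fun w => w.1.sum_pos.ne')

variable [DecidableEq P]

/-- The total weight that a point of a simplex gives to each element of the poset. -/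
noncomputable def chainWeight {n : ℕ} (c : Fin (n + 1) →o P) (t : stdSimplex ℝ (Fin (n + 1)))
    (p : P) : ℝ≥0 :=
  ∑ i with c i = p, (t i).toNNReal

theorem chainWeight_comp {n m : ℕ} (c : Fin (m + 1) →o P) (f : Fin (n + 1) →o Fin (m + 1))
    (t : stdSimplex ℝ (Fin (n + 1))) :
    chainWeight (c.comp f) t = chainWeight c (stdSimplex.map f t) := by
  funext p
  simp only [chainWeight, stdSimplex.map_coe, FunOnFinite.linearMap_apply_apply]
  rw [← Finset.sum_fiberwise_of_maps_to (t := {j | c j = p}) (g := f)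
    (fun i hi => by simpa using hi)]
  refine Finset.sum_congr rfl fun j hj => ?_
  rw [Real.toNNReal_sum_of_nonneg fun i _ => stdSimplex.zero_le t i]
  refine Finset.sum_congr ?_ fun _ _ => rfl
  ext i
  simp only [Finset.mem_filter_univ] at hj
  simp only [OrderHom.comp_coe, Function.comp_apply, Finset.mem_filter, Finset.mem_univ, true_and,
    and_iff_right_iff_imp]
  rintro rfl
  exact hj

theorem sum_chainWeight [Fintype P] {n : ℕ} (c : Fin (n + 1) →o P)
    (t : stdSimplex ℝ (Fin (n + 1))) :
    ∑ p, chainWeight c t p = 1 := by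
  simp only [chainWeight]
  rw [Finset.sum_fiberwise]
  rw [← NNReal.coe_inj]
  push_cast
  simp [stdSimplex.zero_le]

theorem continuous_chainWeight {n : ℕ} (c : Fin (n + 1) →o P) : Continuous (chainWeight c) := by
  refine continuous_pi fun p => continuous_finsetSum _ fun i _ => ?_
  exact continuous_real_toNNReal.comp ((continuous_apply i).comp continuous_subtype_val)

theorem chainWeight_of_injective {n : ℕ} {c : Fin (n + 1) →o P} (hc : Function.Injective c)
    (t : stdSimplex ℝ (Fin (n + 1))) (i : Fin (n + 1)) :
    chainWeight c t (c i) = (t i).toNNReal := by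
  simp [chainWeight, hc.eq_iff, Finset.filter_eq']

theorem exists_of_chainWeight_ne_zero {n : ℕ} {c : Fin (n + 1) →o P}
    {t : stdSimplex ℝ (Fin (n + 1))} {p : P} (h : chainWeight c t p ≠ 0) : ∃ i, c i = p := by
  obtain ⟨i, hi, -⟩ := Finset.exists_ne_zero_of_sum_ne_zero h
  exact ⟨i, by simpa using hi⟩

/-- Every point of the order complex lies in the interior of a nondegenerate simplex. -/
theorem exists_strictMono_chainMap_eq {n : ℕ} (c : Fin (n + 1) →o P)
    (t : stdSimplex ℝ (Fin (n + 1))) : ∃ (m : ℕ) (d : Fin (m + 1) →o P)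
      (u : stdSimplex ℝ (Fin (m + 1))), StrictMono d ∧ (∀ j, u j ≠ 0) ∧
        chainMap c t = chainMap d u ∧ chainWeight c t = chainWeight d u := by
  have hex : ∀ i, ∃ j, c j = c i := fun i => ⟨i, rfl⟩
  let ρ : Fin (n + 1) →o Fin (n + 1) :=
    { toFun i := Fin.find (fun j => c j = c i) (hex i)
      monotone' i i' h := by
        rcases (c.monotone h).eq_or_lt with h' | h'
        · simp only [h', le_refl]
        · by_contra! hlt
          have h1 := Fin.find_spec (hex i)
          have h2 := Fin.find_spec (hex i')
          have := c.monotone hlt.le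
          rw [h1, h2] at this
          exact this.not_gt h' }
  have hρ : c.comp ρ = c := by
    ext i
    exact Fin.find_spec (hex i)
  have hρρ : ∀ i j, c i = c j → ρ i = ρ j := by
    intro i j h
    have : (fun k => c k = c i) = fun k => c k = c j := by rw [h]
    change Fin.find _ _ = Fin.find _ _
    simp only [this]
  set t' := stdSimplex.map ρ t with ht'
  have hinj : ∀ i j, t' i ≠ 0 → t' j ≠ 0 → c i = c j → i = j := by
    have key : ∀ i, t' i ≠ 0 → ρ i = i := by
      intro i hi
      rw [ht', stdSimplex.map_coe, FunOnFinite.linearMap_apply_apply] at hi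
      obtain ⟨k, hk, -⟩ := Finset.exists_ne_zero_of_sum_ne_zero hi
      have hk : ρ k = i := by simpa using hk
      rw [← hk]
      exact hρρ _ _ (DFunLike.congr_fun hρ k)
    intro i j hi hj h
    rw [← key i hi, ← key j hj, hρρ i j h]
  have hm : ∃ m, (Finset.univ.filter fun i => t' i ≠ 0).card = m + 1 := by
    refine Nat.exists_eq_succ_of_ne_zero fun h => ?_
    rw [Finset.card_eq_zero, Finset.filter_eq_empty_iff] at h
    have h1 := stdSimplex.sum_eq_one t'
    rw [Finset.sum_eq_zero fun i hi => by simpa using h hi] at h1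
    exact zero_ne_one h1
  obtain ⟨m, hm⟩ := hm
  let ι : Fin (m + 1) ↪o Fin (n + 1) := Finset.orderEmbOfFin _ hm
  have hι : ∀ j, t' (ι j) ≠ 0 := fun j =>
    (Finset.mem_filter.1 (Finset.orderEmbOfFin_mem _ hm j)).2
  have hι' : ∀ i, t' i ≠ 0 → ∃ j, ι j = i := fun i hi => by
    have : i ∈ Set.range ι := by
      rw [Finset.range_orderEmbOfFin]
      simpa using hi
    exact this
  have hsum : ∑ j, t' (ι j) = 1 := by
    rw [← stdSimplex.sum_eq_one t']
    refine Finset.sum_of_injOn ι ι.injective.injOn (by simp) (fun i _ hi => ?_) fun _ _ => rfl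
    by_contra h0
    exact hi (by simpa using hι' i h0)
  let u : stdSimplex ℝ (Fin (m + 1)) := ⟨fun j => t' (ι j), fun j => stdSimplex.zero_le t' _, hsum⟩
  have hu : stdSimplex.map ι u = t' := by
    ext i
    rw [stdSimplex.map_coe, FunOnFinite.linearMap_apply_apply]
    by_cases hi : t' i = 0
    · rw [hi]
      refine Finset.sum_eq_zero fun j hj => ?_
      rw [← hi, ← (Finset.mem_filter.1 hj).2]
      rfl
    · obtain ⟨j, rfl⟩ := hι' i hi
      simp only [EmbeddingLike.apply_eq_iff_eq, Finset.filter_eq', Finset.mem_univ, if_true,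
        Finset.sum_singleton]
      rfl
  refine ⟨m, c.comp (ι : Fin (m + 1) →o Fin (n + 1)), u, ?_, hι, ?_, ?_⟩
  · exact (c.monotone.comp ι.monotone).strictMono_of_injective fun i j h =>
      ι.injective (hinj _ _ (hι i) (hι j) h)
  · rw [chainMap_comp]
    conv_lhs => rw [← hρ, chainMap_comp]
    exact congrArg _ hu.symm
  · rw [chainWeight_comp]
    conv_lhs => rw [← hρ, chainWeight_comp]
    exact congrArg _ hu.symm

theorem chainMap_eq_of_chainWeight_eq {n m : ℕ} {c : Fin (n + 1) →o P} {d : Fin (m + 1) →o P}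
    {t : stdSimplex ℝ (Fin (n + 1))} {u : stdSimplex ℝ (Fin (m + 1))}
    (h : chainWeight c t = chainWeight d u) : chainMap c t = chainMap d u := by
  obtain ⟨n', c', t', hc, ht, h1, h1'⟩ := exists_strictMono_chainMap_eq c t
  obtain ⟨m', d', u', hd, hu, h2, h2'⟩ := exists_strictMono_chainMap_eq d u
  rw [h1, h2]
  have hw : chainWeight c' t' = chainWeight d' u' := by rw [← h1', ← h2', h]
  have key : ∀ {k : ℕ} {e : Fin (k + 1) →o P} {v : stdSimplex ℝ (Fin (k + 1))}, StrictMono e →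
      (∀ j, v j ≠ 0) → Set.range e = Function.support (chainWeight e v) := by
    intro k e v he hv
    ext p
    refine ⟨?_, exists_of_chainWeight_ne_zero⟩
    rintro ⟨i, rfl⟩
    rw [Function.mem_support, chainWeight_of_injective he.injective]
    simpa using (stdSimplex.zero_le v i).lt_of_ne' (hv i)
  have hr : Set.range c' = Set.range d' := by rw [key hc ht, key hd hu, hw]
  obtain rfl : n' = m' := by
    have h3 := Nat.card_range_of_injective hc.injective
    have h4 := Nat.card_range_of_injective hd.injective
    rw [hr, h4] at h3
    simpa using h3.symm
  obtain rfl : c' = d' := DFunLike.coe_injective ((hc.range_inj hd).1 hr)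
  congr 1
  ext i
  have := congrFun hw (c' i)
  rw [chainWeight_of_injective hc.injective, chainWeight_of_injective hc.injective] at this
  exact (Real.toNNReal_eq_toNNReal_iff (stdSimplex.zero_le _ _) (stdSimplex.zero_le _ _)).1 this

/-- The monotone map underlying a simplex of the nerve of a poset. -/
def nerveOrderHom {n : ℕ} (a : ComposableArrows P n) : Fin (n + 1) →o P where
  toFun := a.obj
  monotone' := a.monotone

/-- The map from a simplex to the chain cone given by a chain. -/
noncomputable def chainWeightMap [Fintype P] {n : ℕ} (c : Fin (n + 1) →o P) :
    C(stdSimplex ℝ (Fin (n + 1)), ChainCone P) where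
  toFun t := ⟨chainWeight c t, fun h => by simpa [h] using sum_chainWeight c t, fun p q hp hq => by
    obtain ⟨i, rfl⟩ := exists_of_chainWeight_ne_zero hp
    obtain ⟨j, rfl⟩ := exists_of_chainWeight_ne_zero hq
    exact (le_total i j).imp (fun h => c.monotone h) fun h => c.monotone h⟩
  continuous_toFun := (continuous_chainWeight c).subtype_mk _

/-- The map from the order complex to the chain cone that sends a point to its barycentric
coordinates. -/
noncomputable def toChainCone (P : Type) [PartialOrder P] [Fintype P] [DecidableEq P] :
    |nerve P| ⟶ TopCat.of (ChainCone P) :=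
  (sSetTopAdj.homEquiv _ _).symm
    { app n := ↾fun a => (TopCat.toSSetObjEquiv (TopCat.of (ChainCone P)) n).symm
        (chainWeightMap (nerveOrderHom (n := n.unop.len) a))
      naturality n m f := by
        ext a
        apply (TopCat.toSSetObjEquiv _ _).injective
        ext t : 1
        apply Subtype.ext
        exact chainWeight_comp (nerveOrderHom (n := n.unop.len) a) f.unop.toOrderHom t }

theorem toChainCone_chainMap [Fintype P] {n : ℕ} (c : Fin (n + 1) →o P)
    (t : stdSimplex ℝ (Fin (n + 1))) : toChainCone P (chainMap c t) = chainWeightMap c t := by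
  refine (toTop_map_characteristicMap (X := nerve P) _ c.monotone.functor t).trans ?_
  rw [toChainCone, Equiv.apply_symm_apply]
  rfl

theorem chainWeight_chainCoords [Fintype P] {n : ℕ} {e : Fin (n + 1) →o P}
    (he : Function.Injective e) (w : {w : ChainCone P // Function.support w.1 ⊆ Set.range e}) :
    chainWeight e (chainCoords he w) = fun p => w.1.1 p / ∑ q, w.1.1 q := by
  funext p
  by_cases hp : p ∈ Set.range e
  · obtain ⟨i, rfl⟩ := hp
    rw [chainWeight_of_injective he]
    exact Real.toNNReal_coe
  · rw [not_imp_comm.1 exists_of_chainWeight_ne_zero hp,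
      Function.notMem_support.1 fun h => hp (w.2 h), zero_div]

/-- Normalisation retracts the chain cone onto the order complex. -/
theorem exists_retraction_toChainCone (P : Type) [PartialOrder P] [Fintype P] [DecidableEq P] :
    ∃ r : C(ChainCone P, |nerve P|), ∀ x, r (toChainCone P x) = x := by
  choose n e he hsupp using fun w : ChainCone P => w.exists_range_eq_support
  let r : ChainCone P → |nerve P| := fun w => chainMap (e w) (chainCoords (he w) ⟨w, hsupp w⟩)
  have hr : ∀ {m : ℕ} {d : Fin (m + 1) →o P} (hd : Function.Injective d)
      (w : {w : ChainCone P // Function.support w.1 ⊆ Set.range d}),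
      r w = chainMap d (chainCoords hd w) := fun hd w => by
    apply chainMap_eq_of_chainWeight_eq
    rw [chainWeight_chainCoords, chainWeight_chainCoords]
  have hcont : Continuous r := by
    let A : Set P → Set (ChainCone P) := fun s => {w | Function.support w.1 ⊆ s ∧
      ∃ (n : ℕ) (e : Fin (n + 1) →o P), Function.Injective e ∧ Set.range e = s}
    refine (locallyFinite_of_finite A).continuous ?_ ?_ ?_
    · refine Set.eq_univ_of_forall fun w => Set.mem_iUnion.2 ⟨_, hsupp w, _, _, he w, rfl⟩
    · intro s
      have : A s = (⋂ p ∈ sᶜ, {w | w.1 p = 0}) ∩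
          {w | ∃ (n : ℕ) (e : Fin (n + 1) →o P), Function.Injective e ∧ Set.range e = s} := by
        ext w
        simp only [A, Set.mem_inter_iff, Set.mem_iInter, Set.mem_ofPred_eq, Set.mem_compl_iff]
        rw [Function.support_subset_iff']
      rw [this]
      refine IsClosed.inter (isClosed_biInter fun p _ => ?_) isClosed_const
      exact isClosed_eq ((continuous_apply p).comp continuous_subtype_val) continuous_const
    · intro s
      by_cases hs : ∃ (n : ℕ) (e : Fin (n + 1) →o P), Function.Injective e ∧ Set.range e = s
      · obtain ⟨m, d, hd, rfl⟩ := hs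
        rw [continuousOn_iff_continuous_domRestrict]
        have h1 : Continuous fun w : A (Set.range d) => chainMap d (chainCoords hd ⟨w.1, w.2.1⟩) :=
          (chainMap d).continuous.comp
            ((continuous_chainCoords hd).comp (continuous_subtype_val.subtype_mk _))
        exact h1.congr fun w => (hr hd ⟨w.1, w.2.1⟩).symm
      · exact fun w hw => absurd hw.2 hs
  refine ⟨⟨r, hcont⟩, fun x => ?_⟩
  suffices h : toChainCone P ≫ TopCat.ofHom ⟨r, hcont⟩ = 𝟙 |nerve P| from
    ConcreteCategory.congr_hom h x
  refine toTop_hom_ext fun n a t => ?_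
  change r (toChainCone P (chainMap (nerveOrderHom a) t)) = chainMap (nerveOrderHom a) t
  rw [toChainCone_chainMap]
  apply chainMap_eq_of_chainWeight_eq
  rw [chainWeight_chainCoords]
  change (fun p => chainWeight (nerveOrderHom a) t p / ∑ q, chainWeight (nerveOrderHom a) t q) = _
  simp [sum_chainWeight]

theorem ContractibleSpace.of_retract {X Y : Type} [TopologicalSpace X] [TopologicalSpace Y]
    [ContractibleSpace Y] (i : C(X, Y)) (r : C(Y, X)) (h : ∀ x, r (i x) = x) :
    ContractibleSpace X := by
  rw [contractible_iff_id_nullhomotopic]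
  have := ((id_nullhomotopic Y).comp_right r).comp_left i
  convert this
  ext x
  exact (h x).symm

end Realization

/-- For any conditional oriented matroid `L` on a finite ground set `E`, the order
complex of the poset of covectors of `L` is contractible. -/
theorem orderComplex_of_COM_contractible {E : Type} [Fintype E]
    (L : Set (E → SignType)) (hL : IsCOM L) :
    ContractibleSpace ↥(orderComplex (Cov L)) := by
  classical
  have := Fintype.ofFinite (Cov L)
  have := hL.contractibleSpace_chainCone Finset.univ fun _ _ e he => absurd (Finset.mem_univ e) he
  obtain ⟨r, hr⟩ := exists_retraction_toChainCone (Cov L)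
  exact ContractibleSpace.of_retract (toChainCone (Cov L)).hom r hr
end

section
/- If (X,T) ⪯ (X',T') in the Salvetti poset Sal(A,K), then U_{X,T} ⊆ U_{X',T'} as subsets of Z(A,K). -/
/-- The Salvetti poset `Sal(A,K)`: pairs `(X,T)` where `T` is a tope of `L(A,K)` and
`X ≤ T`. -/
@[ext]
structure SalP {E : Type*} {V : Type*} [NormedAddCommGroup V] [NormedSpace ℝ V]
    (f : E → (V →ᵃ[ℝ] ℝ)) (K : Set V) where
  X : E → SignType
  T : E → SignType
  memX : X ∈ covs f K
  topeT : IsTope f K T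
  leXT : sle X T

/-- The partial order on the Salvetti poset: `(X,T) ⪯ (X',T')` iff `X ≤ X'` and
`X' ∘ T = T'`. -/
instance {E : Type*} {V : Type*} [NormedAddCommGroup V] [NormedSpace ℝ V]
    (f : E → (V →ᵃ[ℝ] ℝ)) (K : Set V) : PartialOrder (SalP f K) where
  le p q := sle p.X q.X ∧ scomp q.X p.T = q.T
  le_refl p := ⟨sle_refl p.X, p.leXT⟩
  le_trans p q r h₁ h₂ := by
    refine ⟨sle_trans h₁.1 h₂.1, ?_⟩
    funext e
    have hc1 := congrFun h₁.2 e
    have hc2 := congrFun h₂.2 e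
    have hc3 := congrFun h₂.1 e
    revert hc1 hc2 hc3
    show (if q.X e = 0 then p.T e else q.X e) = q.T e →
      (if r.X e = 0 then q.T e else r.X e) = r.T e →
      (if q.X e = 0 then r.X e else q.X e) = r.X e →
      (if r.X e = 0 then p.T e else r.X e) = r.T e
    generalize q.X e = a; generalize p.T e = b; generalize q.T e = c
    generalize r.X e = d; generalize r.T e = g
    revert a b c d g; decide
  le_antisymm p q h₁ h₂ := by
    have hX : p.X = q.X := sle_antisymm h₁.1 h₂.1
    have hT : q.T = p.T := by rw [← h₁.2, hX.symm]; exact p.leXT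
    ext1 <;> simp [hX, hT.symm]

variable {V : Type*} [NormedAddCommGroup V] [NormedSpace ℝ V] [FiniteDimensional ℝ V]
variable {E : Type*} [Fintype E]

/-- If `(X,T) ⪯ (X',T')` in the Salvetti poset `Sal(A,K)`, then `U_{X,T} ⊆ U_{X',T'}`
as subsets of `Z(A,K)`. -/
theorem UXT_subset_of_le
    (f : E → (V →ᵃ[ℝ] ℝ)) (hf : ∀ e, (f e).linear ≠ 0)
    (K : Set V) (hKne : K.Nonempty) (hKconv : Convex ℝ K) (hKopen : IsOpen K)
    (p q : SalP f K) (hpq : p ≤ q) :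
    UXT f K p.X ⟨p.T, p.topeT⟩ ⊆ UXT f K q.X ⟨q.T, q.topeT⟩ := by
  rintro z ⟨v, hv, hvX, rfl⟩
  obtain ⟨hX, hT⟩ := hpq
  have hsign : ∀ e, p.X e = 0 → SignType.sign (f e v) = p.T e := by
    simpa [KXT, hv] using hvX
  refine ⟨v, hv, ⟨hv, ?_⟩, Quot.sound ⟨rfl, fun e he hfe => ?_⟩⟩
  · simp only [Set.mem_iInter, Set.mem_ofPred_eq]
    intro e he
    have hpX : p.X e = 0 := by
      have h := congrFun hX e
      simp only [scomp, he] at h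
      grind
    have hTe := congrFun hT e
    simp only [scomp, he, if_true] at hTe
    rw [hsign e hpX, hTe]
  · have h₁ := congrFun hX e
    have h₂ := congrFun hT e
    have h₃ := congrFun p.leXT e
    have h₄ := hsign e
    rw [hfe, sign_zero] at h₄
    simp only [SepSet, Set.mem_ofPred_eq] at he
    simp only [scomp] at h₁ h₂ h₃
    revert h₁ h₂ h₃ h₄ he
    generalize p.X e = a; generalize q.X e = b
    generalize p.T e = c; generalize q.T e = d
    revert a b c d; decide
end
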